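/- Assume the Riemann Hypothesis. Let q : [1, ∞) → ℂ be a measurable function with q(x) = o(1) as x → +∞. Then there exist a set 𝒫 of primes and a function χ : 𝒫 → ℂ with |χ(p)| = 1 for all p ∈ 𝒫 such that r(x) := ∫₁^x q(y) dy − Σ_{p ≤ x, p ∈ 𝒫} χ(p) log p satisfies r(x) = O(√x (log x)²) as x → ∞. -/

import Mathlib

open Complex Filter Topology Set MeasureTheory

namespace VK

lemma landau_nozero (f : ℂ → ℂ) (hf : Differentiable ℂ f) {M L : ℝ} (hL : 0 < L)
    (hM : ∀ w, ‖w‖ ≤ 7/4 → ‖f w‖ ≤ M) (hML : M ≤ Real.exp L * ‖f 0‖)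
    (h0 : ∀ w, ‖w‖ < 8/5 → f w ≠ 0) {z : ℂ} (hz : ‖z‖ ≤ 3/2) :
    ‖deriv f z / f z‖ ≤ 2000 * L := by
  have hd : DifferentiableOn ℂ (fun w => deriv f w / f w) (Metric.ball 0 (8/5)) := by
    apply DifferentiableOn.div
    · exact (hf.contDiff (n := 2)).differentiable_deriv_two.differentiableOn
    · exact hf.differentiableOn
    · intro w hw; exact h0 w (by simpa using hw)
  obtain ⟨F0, hF0⟩ := hd.isExactOn_ball
  set F : ℂ → ℂ := fun w => F0 w - F0 0 with hF
  have hFd : ∀ w ∈ Metric.ball (0:ℂ) (8/5), HasDerivAt F (deriv f w / f w) w := by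
    intro w hw
    exact (hF0 w hw).sub_const _
  have hFdiff : DifferentiableOn ℂ F (Metric.ball 0 (8/5)) := fun w hw =>
    (hFd w hw).differentiableAt.differentiableWithinAt
  have hFzero : F 0 = 0 := by simp [hF]
  -- f = f 0 * exp F
  have hexp : ∀ w ∈ Metric.ball (0:ℂ) (8/5), f w = f 0 * Complex.exp (F w) := by
    have key : ∀ w ∈ Metric.ball (0:ℂ) (8/5), HasDerivAt (fun w => f w * Complex.exp (-F w)) 0 w := by
      intro w hw
      have h1 := (hf w).hasDerivAt.mul ((hFd w hw).neg.cexp)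
      refine h1.congr_deriv ?_
      have := h0 w (by simpa using hw)
      field_simp
      ring
    intro w hw
    have := (Metric.isOpen_ball (x := (0:ℂ)) (ε := 8/5)).is_const_of_deriv_eq_zero
      (convex_ball _ _).isPreconnected
      (fun w hw => (key w hw).differentiableAt.differentiableWithinAt)
      (fun w hw => (key w hw).deriv) hw (Metric.mem_ball_self (by norm_num))
    simp only [hFzero, neg_zero, Complex.exp_zero, mul_one] at this
    rw [← this, mul_assoc, ← Complex.exp_add]; simp
  have h00 : f 0 ≠ 0 := h0 0 (by norm_num)
  have hre : Set.MapsTo F (Metric.ball 0 (8/5)) {z | z.re ≤ L} := by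
    intro w hw
    have h1 := hexp w hw
    have h2 := hM w (by have : ‖w‖ < 8/5 := by simpa using hw
                        linarith)
    rw [h1, norm_mul, Complex.norm_exp] at h2
    have h3 : 0 < ‖f 0‖ := norm_pos_iff.mpr h00
    have h4 : Real.exp (F w).re ≤ Real.exp L := by
      have : ‖f 0‖ * Real.exp (F w).re ≤ ‖f 0‖ * Real.exp L := by linarith
      exact le_of_mul_le_mul_left this h3
    exact Real.exp_le_exp.mp h4
  have hBC : ∀ w, ‖w‖ ≤ 31/20 → ‖F w‖ ≤ 62 * L := by
    intro w hw
    have := borelCaratheodory_zero hL hFdiff hre (by norm_num) (z := w)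
      (by simp; linarith) hFzero
    refine this.trans ?_
    rw [div_le_iff₀ (by linarith)]
    nlinarith
  have hz' : z ∈ Metric.ball (0:ℂ) (8/5) := by simp; linarith
  rw [← (hFd z hz').deriv]
  have := norm_deriv_le_of_forall_mem_sphere_norm_le (c := z) (R := 1/20) (C := 62 * L) (f := F)
    (by norm_num) ?_ ?_
  · refine this.trans ?_
    rw [div_le_iff₀ (by norm_num)]; linarith
  · apply DifferentiableOn.diffContOnCl
    refine hFdiff.mono ?_
    rw [closure_ball _ (by norm_num)]
    intro w hw
    simp only [Metric.mem_closedBall, dist_eq_norm, Metric.mem_ball, sub_zero] at hw ⊢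
    have : ‖w‖ ≤ ‖w - z‖ + ‖z‖ := by simpa using norm_add_le (w - z) z
    linarith
  · intro w hw
    apply hBC
    simp only [mem_sphere_iff_norm] at hw
    have : ‖w‖ ≤ ‖w - z‖ + ‖z‖ := by simpa using norm_add_le (w - z) z
    linarith

lemma blaschke_norm {ρ w : ℂ} {R : ℝ} (hw : ‖w‖ = R) :
    ‖((R:ℂ)^2 - (starRingEnd ℂ) ρ * w)‖ = R * ‖w - ρ‖ := by
  have h1 : ((R:ℂ)^2) = w * (starRingEnd ℂ) w := by
    rw [Complex.mul_conj, Complex.normSq_eq_norm_sq, hw]; push_cast; rfl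
  rw [h1, show w * (starRingEnd ℂ) w - (starRingEnd ℂ) ρ * w = w * (starRingEnd ℂ) (w - ρ) by
    rw [map_sub]; ring, norm_mul, RCLike.norm_conj, hw]

lemma landau_ind (n : ℕ) {M L δ : ℝ} (hL : 0 < L) (hδ : 0 < δ) (hδ1 : δ ≤ 1) {z : ℂ} (hz : ‖z‖ ≤ 3/2) :
    ∀ (f : ℂ → ℂ) (_ : Differentiable ℂ f)
    (_ : ∀ w, ‖w‖ ≤ 7/4 → ‖f w‖ ≤ M) (_ : M ≤ Real.exp L * ‖f 0‖) (_ : f 0 ≠ 0)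
    (_ : ∀ w, ‖w‖ < 8/5 → f w = 0 → δ ≤ ‖z - w‖)
    (_ : M < ‖f 0‖ * (35/32)^n),
    ‖deriv f z / f z‖ ≤ 2000 * L + n * (4 / δ) := by
  induction n with
  | zero =>
    intro f hf hM hML h0 hzero hn
    have := hM 0 (by norm_num)
    simp at hn
    linarith
  | succ n ih =>
    intro f hf hM hML h0 hzero hn
    by_cases hno : ∀ w, ‖w‖ < 8/5 → f w ≠ 0
    · have := landau_nozero f hf hL hM hML hno hz
      have h2 : 0 ≤ ((n+1 : ℕ):ℝ) * (4/δ) := by positivity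
      linarith
    push Not at hno
    obtain ⟨ρ, hρ, hfρ⟩ := hno
    set p : ℂ → ℂ := fun w => ((7/4:ℝ):ℂ)^2 - (starRingEnd ℂ) ρ * w with hp
    set g : ℂ → ℂ := fun w => dslope f ρ w * (p w / ((7/4:ℝ):ℂ)) with hg
    have hds : Differentiable ℂ (dslope f ρ) := by
      rw [← differentiableOn_univ]
      exact (Complex.differentiableOn_dslope univ_mem).mpr hf.differentiableOn
    have hpd : Differentiable ℂ p := by
      intro w; simp only [hp]; fun_prop
    have hgd : Differentiable ℂ g := hds.mul (hpd.div_const _)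
    have hfac : ∀ w, f w = (w - ρ) * dslope f ρ w := by
      intro w
      have := sub_smul_dslope f ρ w
      rw [smul_eq_mul, hfρ, sub_zero] at this
      exact this.symm
    have hpne : ∀ w, ‖w‖ ≤ 7/4 → (53/80:ℝ) * 0 < ‖p w‖ := by
      intro w hw
      have h1 : ‖(starRingEnd ℂ) ρ * w‖ ≤ 8/5 * (7/4) := by
        rw [norm_mul, RCLike.norm_conj]; gcongr
      have h2 : ‖((7/4:ℝ):ℂ)^2‖ = 49/16 := by
        rw [norm_pow, Complex.norm_real]; norm_num
      have := norm_sub_norm_le (((7/4:ℝ):ℂ)^2) ((starRingEnd ℂ) ρ * w)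
      simp only [hp]
      linarith
    have hpz : (53/80:ℝ) ≤ ‖p z‖ := by
      have h1 : ‖(starRingEnd ℂ) ρ * z‖ ≤ 8/5 * (3/2) := by
        rw [norm_mul, RCLike.norm_conj]; gcongr
      have h2 : ‖((7/4:ℝ):ℂ)^2‖ = 49/16 := by
        rw [norm_pow, Complex.norm_real]; norm_num
      have := norm_sub_norm_le (((7/4:ℝ):ℂ)^2) ((starRingEnd ℂ) ρ * z)
      simp only [hp]
      linarith
    have hgM : ∀ w, ‖w‖ ≤ 7/4 → ‖g w‖ ≤ M := by
      intro w hw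
      refine Complex.norm_le_of_forall_mem_frontier_norm_le (U := Metric.ball 0 (7/4))
        Metric.isBounded_ball hgd.diffContOnCl ?_ ?_
      · intro v hv
        rw [frontier_ball _ (by norm_num), mem_sphere_iff_norm, sub_zero] at hv
        have h1 := blaschke_norm (ρ := ρ) hv
        have h2 := hM v hv.le
        rw [hfac, norm_mul] at h2
        simp only [hg, hp]
        rw [norm_mul, norm_div, h1, Complex.norm_real]
        norm_num
        linarith [mul_comm ‖dslope f ρ v‖ ‖v - ρ‖]
      · rw [closure_ball _ (by norm_num)]; simpa using hw
    have hρ0 : ρ ≠ 0 := by rintro rfl; exact h0 hfρ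
    have hρpos : 0 < ‖ρ‖ := norm_pos_iff.mpr hρ0
    have hg0 : ‖f 0‖ * (35/32) ≤ ‖g 0‖ := by
      have h1 : ‖f 0‖ = ‖ρ‖ * ‖dslope f ρ 0‖ := by rw [hfac 0]; simp
      have h2 : ‖g 0‖ = ‖dslope f ρ 0‖ * (7/4) := by
        simp only [hg, hp]
        rw [norm_mul, norm_div]; simp
        norm_num
      rw [h1, h2]
      nlinarith [norm_nonneg (dslope f ρ 0)]
    have hf0pos : 0 < ‖f 0‖ := norm_pos_iff.mpr h0
    have hgz : ∀ w, ‖w‖ < 8/5 → g w = 0 → δ ≤ ‖z - w‖ := by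
      intro w hw hgw
      apply hzero w hw
      have h1 : p w ≠ 0 := by
        have := hpne w (by linarith)
        rw [mul_zero] at this
        exact norm_pos_iff.mp this
      have h2 : dslope f ρ w = 0 := by
        simp only [hg] at hgw
        rcases mul_eq_zero.mp hgw with h | h
        · exact h
        · exfalso; rcases div_eq_zero_iff.mp h with h | h
          · exact h1 h
          · norm_num at h
      rw [hfac, h2, mul_zero]
    have hind := ih g hgd hgM (by nlinarith [Real.exp_pos L]) (by
        rw [← norm_pos_iff]; linarith) hgz (by
        rw [pow_succ] at hn
        have : (0:ℝ) < (35/32)^n := by positivity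
        nlinarith)
    -- log derivative
    have hzρ : δ ≤ ‖z - ρ‖ := hzero ρ hρ hfρ
    have hzρ' : z - ρ ≠ 0 := by
      intro h; rw [h, norm_zero] at hzρ; linarith
    have hpz' : p z ≠ 0 := by
      rw [← norm_pos_iff]; linarith
    by_cases hfz : f z = 0
    · rw [hfz, div_zero, norm_zero]; positivity
    have hdz : dslope f ρ z ≠ 0 := by
      intro h; rw [hfac, h, mul_zero] at hfz; exact hfz rfl
    have hderivf : deriv f z = dslope f ρ z + (z - ρ) * deriv (dslope f ρ) z := by
      have h1 : HasDerivAt (fun w => (w - ρ) * dslope f ρ w) (1 * dslope f ρ z + (z - ρ) * deriv (dslope f ρ) z) z :=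
        ((hasDerivAt_id z).sub_const ρ).mul (hds z).hasDerivAt
      rw [← (funext hfac : f = _)] at h1
      rw [h1.deriv, one_mul]
    have hpder : HasDerivAt p (-(starRingEnd ℂ) ρ) z := by
      simp only [hp]
      have := ((hasDerivAt_id z).const_mul ((starRingEnd ℂ) ρ)).const_sub (((7/4:ℝ):ℂ)^2)
      simpa using this
    have hderivg : deriv g z = deriv (dslope f ρ) z * (p z / ((7/4:ℝ):ℂ)) + dslope f ρ z * (-(starRingEnd ℂ) ρ / ((7/4:ℝ):ℂ)) :=
      ((hds z).hasDerivAt.mul (hpder.div_const _)).deriv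
    have heq : deriv f z / f z = deriv g z / g z + 1 / (z - ρ) + (starRingEnd ℂ) ρ / p z := by
      rw [hderivf, hderivg, hfac z]
      simp only [hg]
      have : ((7/4:ℝ):ℂ) ≠ 0 := by norm_num
      field_simp
      ring
    rw [heq]
    have e1 : ‖1 / (z - ρ)‖ ≤ 1 / δ := by
      rw [norm_div, norm_one]
      exact one_div_le_one_div_of_le hδ hzρ
    have e2 : ‖(starRingEnd ℂ) ρ / p z‖ ≤ 3 := by
      rw [norm_div, RCLike.norm_conj, div_le_iff₀ (by linarith)]
      linarith
    have e3 : (3:ℝ) ≤ 3 / δ := by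
      rw [le_div_iff₀ hδ]; linarith
    have e4 := norm_add₃_le (a := deriv g z / g z) (b := 1 / (z - ρ)) (c := (starRingEnd ℂ) ρ / p z)
    have e5 : ((n+1:ℕ):ℝ) * (4/δ) = n * (4/δ) + 1/δ + 3/δ := by push_cast; ring
    rw [e5]
    linarith

lemma landau (f : ℂ → ℂ) (hf : Differentiable ℂ f) {M L δ : ℝ} (hL : 1 ≤ L) (hδ : 0 < δ)
    (hδ1 : δ ≤ 1) {z : ℂ} (hz : ‖z‖ ≤ 3/2)
    (hM : ∀ w, ‖w‖ ≤ 7/4 → ‖f w‖ ≤ M) (hML : M ≤ Real.exp L * ‖f 0‖) (h0 : f 0 ≠ 0)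
    (hzero : ∀ w, ‖w‖ < 8/5 → f w = 0 → δ ≤ ‖z - w‖) :
    ‖deriv f z / f z‖ ≤ 2100 * L / δ := by
  set n := ⌊35/3 * L⌋₊ + 1
  have hn : 35/3 * L < n := by simpa [n] using Nat.lt_floor_add_one (35/3 * L)
  have hn2 : (n:ℝ) ≤ 35/3 * L + 1 := by
    simpa [n] using Nat.floor_le (by positivity : 0 ≤ 35/3 * L)
  have hlog : (3/35:ℝ) ≤ Real.log (35/32) := by
    have := Real.one_sub_inv_le_log_of_pos (by norm_num : (0:ℝ) < 35/32)
    norm_num at this ⊢; linarith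
  have h1 : Real.exp L < (35/32:ℝ)^n := by
    rw [← Real.exp_log (by positivity : (0:ℝ) < (35/32)^n), Real.exp_lt_exp, Real.log_pow]
    nlinarith
  have hf0pos : 0 < ‖f 0‖ := norm_pos_iff.mpr h0
  have := landau_ind n (by linarith) hδ hδ1 hz f hf hM hML h0 hzero (by nlinarith)
  refine this.trans ?_
  rw [le_div_iff₀ hδ]
  have e : (2000 * L + n * (4/δ)) * δ = 2000 * L * δ + n * 4 := by field_simp
  rw [e]
  nlinarith

end VK


namespace VK

noncomputable def Z : ℂ → ℂ := Function.update (fun s => (s-1)*riemannZeta s) 1 1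

lemma Z_one : Z 1 = 1 := by simp [Z]
lemma Z_ne {s : ℂ} (hs : s ≠ 1) : Z s = (s-1)*riemannZeta s := by simp [Z, hs]

lemma Z_diff : Differentiable ℂ Z := by
  rw [← differentiableOn_univ,
    ← differentiableOn_compl_singleton_and_continuousAt_iff (c := 1) Filter.univ_mem]
  refine ⟨DifferentiableOn.congr (f := fun s ↦ (s - 1) * riemannZeta s)
    (fun s hs ↦ DifferentiableAt.differentiableWithinAt ?_) fun s hs ↦ Z_ne (by simpa using hs), ?_⟩
  · have := differentiableAt_riemannZeta (s := s) (by simpa using hs)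
    fun_prop
  · rw [Z, continuousAt_update_same]
    exact riemannZeta_residue_one

lemma Z_zero_re (hRH : RiemannHypothesis) {s : ℂ} (h : Z s = 0) : s.re ≤ 1/2 := by
  by_cases h1 : s = 1
  · rw [h1, Z_one] at h; norm_num at h
  rw [Z_ne h1] at h
  have h2 : riemannZeta s = 0 := by
    rcases mul_eq_zero.mp h with h | h
    · exact absurd (sub_eq_zero.mp h) h1
    · exact h
  by_cases h3 : ∃ n : ℕ, s = -2 * (n + 1)
  · obtain ⟨n, rfl⟩ := h3
    simp
    have : (0:ℝ) ≤ n := by positivity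
    linarith
  · exact (hRH s h2 h3 h1).le

noncomputable def fr : ℝ → ℂ := indicator (Ioi 1) (fun u => ((Int.fract u : ℝ) : ℂ))

lemma fr_norm (u : ℝ) : ‖fr u‖ ≤ 1 := by
  unfold fr
  by_cases h : u ∈ Ioi (1:ℝ)
  · rw [indicator_of_mem h, Complex.norm_real, Real.norm_of_nonneg (Int.fract_nonneg u)]
    exact (Int.fract_lt_one u).le
  · rw [indicator_of_notMem h]; simp

lemma fr_meas : Measurable fr := by
  unfold fr
  exact (Complex.measurable_ofReal.comp measurable_fract).indicator measurableSet_Ioi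

lemma fr_li : LocallyIntegrableOn fr (Ioi 0) := by
  have : LocallyIntegrable fr := by
    refine (locallyIntegrable_const (1:ℝ)).mono fr_meas.aestronglyMeasurable ?_
    exact Eventually.of_forall fun u => by simpa using fr_norm u
  exact this.locallyIntegrableOn _

lemma fr_mellin_diff {s : ℂ} (hs : 0 < s.re) : DifferentiableAt ℂ (mellin fr) (-s) := by
  refine mellin_differentiableAt_of_isBigO_rpow (a := 0) (b := -s.re - 1) fr_li ?_ ?_ ?_ ?_
  · refine Asymptotics.IsBigO.of_bound 1 (Eventually.of_forall fun u => ?_)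
    simpa using fr_norm u
  · simpa using hs
  · refine Asymptotics.IsBigO.of_bound 1 ?_
    have : ∀ᶠ u : ℝ in 𝓝[>] 0, u < 1 := by
      apply eventually_nhdsWithin_of_eventually_nhds
      exact eventually_lt_nhds (by norm_num)
    filter_upwards [this] with u hu
    rw [fr, indicator_of_notMem (by simpa using hu.le)]
    simp
  · simp

lemma fr_mellin_norm {s : ℂ} (hs : 1/4 ≤ s.re) : ‖mellin fr (-s)‖ ≤ 4 := by
  have h1 : mellin fr (-s) = ∫ u in Ioi (1:ℝ), (u:ℂ)^(-s-1) * fr u := by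
    unfold mellin
    rw [← integral_indicator measurableSet_Ioi, ← integral_indicator measurableSet_Ioi]
    congr 1
    ext u
    by_cases h : 1 < u
    · rw [indicator_of_mem (by simpa using (by linarith : 0 < u)), indicator_of_mem (by simpa using h)]
      simp
    · rw [indicator_of_notMem (s := Ioi 1) (by simpa using h)]
      by_cases h0 : 0 < u
      · rw [indicator_of_mem (by simpa using h0), fr, indicator_of_notMem (by simpa using h)]; simp
      · rw [indicator_of_notMem (by simpa using h0)]
  rw [h1]
  have h2 : ∫ u in Ioi (1:ℝ), u ^ (-s.re-1) ≤ 4 := by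
    rw [integral_Ioi_rpow_of_lt (by linarith) (by norm_num)]
    simp
    rw [inv_le_comm₀ (by linarith) (by norm_num)]; linarith
  refine le_trans (norm_integral_le_of_norm_le (integrableOn_Ioi_rpow_of_lt (a := -s.re-1) (by linarith) (by norm_num : (0:ℝ) < 1)) ?_) h2
  refine (ae_restrict_iff' measurableSet_Ioi).mpr (Eventually.of_forall fun u hu => ?_)
  have hu' : (0:ℝ) < u := lt_trans one_pos hu
  rw [norm_mul, Complex.norm_cpow_eq_rpow_re_of_pos hu']
  simp
  have := fr_norm u
  have h3 : 0 ≤ u ^ (-s.re-1) := by positivity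
  nlinarith

lemma Z_eq_big {s : ℂ} (hs : 1 < s.re) : Z s = s - s * (s-1) * mellin fr (-s) := by
  have hs1 : s ≠ 1 := by rintro rfl; simp at hs
  have hs1' : s - 1 ≠ 0 := sub_ne_zero.mpr hs1
  rw [Z_ne hs1]
  have h1 : mellin fr (-s) = ∫ u in Ioi (1:ℝ), (Int.fract u : ℝ) * (u:ℂ)^(-(s+1)) := by
    unfold mellin
    rw [← integral_indicator measurableSet_Ioi, ← integral_indicator measurableSet_Ioi]
    congr 1
    ext u
    by_cases h : 1 < u
    · rw [indicator_of_mem (by simpa using (by linarith : 0 < u)), indicator_of_mem (by simpa using h), fr, indicator_of_mem (by simpa using h)]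
      rw [smul_eq_mul, mul_comm]; congr 2; ring
    · rw [indicator_of_notMem (s := Ioi 1) (by simpa using h)]
      by_cases h0 : 0 < u
      · rw [indicator_of_mem (by simpa using h0), fr, indicator_of_notMem (by simpa using h)]; simp
      · rw [indicator_of_notMem (by simpa using h0)]
  have hI : IntegrableOn (fun u : ℝ => (u:ℂ)^(-s)) (Ioi 1) :=
    integrableOn_Ioi_cpow_of_lt (by simpa using hs) one_pos
  have hI2 : IntegrableOn (fun u : ℝ => (Int.fract u : ℝ) * (u:ℂ)^(-(s+1))) (Ioi 1) := by
    have : IntegrableOn (fun u : ℝ => (u:ℂ)^(-(s+1))) (Ioi 1) :=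
      integrableOn_Ioi_cpow_of_lt (by simp; linarith) one_pos
    refine Integrable.bdd_mul (c := 1) this (Complex.measurable_ofReal.comp measurable_fract).aestronglyMeasurable ?_
    refine Eventually.of_forall fun u => ?_
    rw [Complex.norm_real, Real.norm_of_nonneg (Int.fract_nonneg u)]
    exact (Int.fract_lt_one u).le
  have h2 : riemannZeta s = s * ∫ t in Set.Ioi (1 : ℝ), (∑ k ∈ Finset.Icc 1 ⌊t⌋₊, (1 : ℕ → ℂ) k) * (t:ℂ) ^ (-(s + 1)) := by
    rw [← LSeries_one_eq_riemannZeta hs]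
    apply LSeries_eq_mul_integral' 1 zero_le_one hs
    refine Asymptotics.IsBigO.of_bound 1 (Eventually.of_forall fun n => ?_)
    simp
  have h3 : ∫ t in Set.Ioi (1 : ℝ), (∑ k ∈ Finset.Icc 1 ⌊t⌋₊, (1 : ℕ → ℂ) k) * (t:ℂ) ^ (-(s + 1)) = (∫ u in Ioi (1:ℝ), (u:ℂ)^(-s)) - ∫ u in Ioi (1:ℝ), (Int.fract u : ℝ) * (u:ℂ)^(-(s+1)) := by
    rw [← integral_sub hI hI2]
    apply setIntegral_congr_fun measurableSet_Ioi
    intro u hu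
    have hu' : (0:ℝ) < u := lt_trans one_pos hu
    have hu0 : (u:ℂ) ≠ 0 := by exact_mod_cast hu'.ne'
    have e1 : (u:ℂ)^(-s) = u * (u:ℂ)^(-(s+1)) := by
      rw [show -s = 1 + (-(s+1)) by ring, Complex.cpow_add _ _ hu0, Complex.cpow_one]
    have e2 : ((⌊u⌋₊ : ℕ) : ℂ) = u - (Int.fract u : ℝ) := by
      have : ((⌊u⌋₊ : ℕ) : ℝ) = u - Int.fract u := by
        rw [natCast_floor_eq_intCast_floor hu'.le, Int.self_sub_fract]
      rw [← Complex.ofReal_sub, ← this]; simp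
    simp only [Pi.one_apply, Finset.sum_const, Nat.card_Icc, add_tsub_cancel_right, nsmul_eq_mul, mul_one]
    rw [e1, e2]; ring
  rw [h2, h3, ← h1, integral_Ioi_cpow_of_lt (by simpa using hs) one_pos]
  simp only [Complex.ofReal_one, Complex.one_cpow]
  have : -s + 1 ≠ 0 := by intro h; apply hs1'; linear_combination -h
  have e : -1 / (-s+1) = 1/(s-1) := by
    field_simp; ring
  rw [e]
  field_simp

lemma Z_eq {s : ℂ} (hs : 0 < s.re) : Z s = s - s * (s-1) * mellin fr (-s) := by
  have hopen : IsOpen {s : ℂ | 0 < s.re} := isOpen_lt continuous_const Complex.continuous_re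
  have h1 : AnalyticOnNhd ℂ Z {s : ℂ | 0 < s.re} :=
    (Z_diff.differentiableOn).analyticOnNhd hopen
  have h2 : AnalyticOnNhd ℂ (fun s => s - s * (s-1) * mellin fr (-s)) {s : ℂ | 0 < s.re} := by
    refine DifferentiableOn.analyticOnNhd (fun s hs => DifferentiableAt.differentiableWithinAt ?_) hopen
    have : DifferentiableAt ℂ (fun s => mellin fr (-s)) s :=
      DifferentiableAt.comp (g := mellin fr) (f := fun s => -s) s (fr_mellin_diff hs) (differentiableAt_id.neg)
    fun_prop
  refine h1.eqOn_of_preconnected_of_eventuallyEq h2 (convex_halfSpace_re_gt 0).isPreconnected (z₀ := 2) (by simp) ?_ hs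
  have : {s : ℂ | 1 < s.re} ∈ 𝓝 (2:ℂ) := (isOpen_lt continuous_const Complex.continuous_re).mem_nhds (by simp)
  filter_upwards [this] with w hw
  exact Z_eq_big hw

lemma Z_growth {s : ℂ} (hs : 1/4 ≤ s.re) : ‖Z s‖ ≤ 5 * (1 + ‖s‖)^2 := by
  rw [Z_eq (by linarith)]
  have h1 := norm_sub_le s (s * (s-1) * mellin fr (-s))
  have h2 : ‖s * (s-1) * mellin fr (-s)‖ ≤ ‖s‖ * (‖s‖ + 1) * 4 := by
    rw [norm_mul, norm_mul]
    gcongr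
    · simpa using norm_sub_le s 1
    · exact fr_mellin_norm hs
  nlinarith [norm_nonneg s]

lemma Z_lower : ∃ c > 0, ∀ t : ℝ, c ≤ ‖Z (2 + t * I)‖ := by
  have hsum : Summable (fun n : ℕ => 1 / (n:ℝ)^2) := Real.summable_one_div_nat_pow.mpr (by norm_num)
  set C := ∑' n : ℕ, 1 / (n:ℝ)^2 with hC
  have hCpos : 0 < C := hsum.tsum_pos (fun n => by positivity) 1 (by norm_num)
  refine ⟨1 / C, by positivity, fun t => ?_⟩
  have hre : (2 + t * I : ℂ).re = 2 := by simp
  have hre1 : 1 < (2 + t * I : ℂ).re := by rw [hre]; norm_num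
  have hne : (2 + t * I : ℂ) ≠ 1 := by intro h; rw [h] at hre; norm_num at hre
  rw [Z_ne hne, norm_mul]
  have h1 : 1 ≤ ‖(2 + t * I : ℂ) - 1‖ := by
    have := Complex.re_le_norm ((2 + t * I : ℂ) - 1)
    simp at this; linarith
  have h2 := ArithmeticFunction.LSeries_zeta_mul_Lseries_moebius hre1
  rw [ArithmeticFunction.LSeries_zeta_eq_riemannZeta hre1] at h2
  have h3 : ‖LSeries (fun n => ((ArithmeticFunction.moebius n : ℤ) : ℂ)) (2 + t * I)‖ ≤ C := by
    unfold LSeries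
    refine tsum_of_norm_bounded hsum.hasSum fun n => ?_
    rw [LSeries.norm_term_eq]
    split_ifs with h
    · simp [h]
    · rw [hre]
      have : ‖((ArithmeticFunction.moebius n : ℤ) : ℂ)‖ ≤ 1 := by
        rw [Complex.norm_intCast]
        exact_mod_cast ArithmeticFunction.abs_moebius_le_one
      have e : (n:ℝ)^(2:ℝ) = (n:ℝ)^2 := by norm_cast
      rw [e]
      gcongr
  have h4 : ‖riemannZeta (2 + t * I)‖ * ‖LSeries (fun n => ((ArithmeticFunction.moebius n : ℤ) : ℂ)) (2 + t * I)‖ = 1 := by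
    rw [← norm_mul, h2, norm_one]
  rw [div_le_iff₀ hCpos]
  calc (1:ℝ) = 1 * (‖riemannZeta (2 + t * I)‖ * ‖LSeries (fun n => ((ArithmeticFunction.moebius n : ℤ) : ℂ)) (2 + t * I)‖) := by rw [h4, one_mul]
    _ ≤ ‖(2 + t * I : ℂ) - 1‖ * (‖riemannZeta (2 + t * I)‖ * C) := by gcongr
    _ = _ := by ring

lemma Z_logDeriv (hRH : RiemannHypothesis) : ∃ C > 0, ∀ δ : ℝ, 0 < δ → δ ≤ 1 → ∀ s : ℂ,
    1/2 + δ ≤ s.re → s.re ≤ 2 → ‖deriv Z s / Z s‖ ≤ C * Real.log (|s.im| + 2) / δ := by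
  obtain ⟨c, hc, hlow⟩ := Z_lower
  set K := |Real.log (32 / c)| + 1 with hK
  have hKpos : 1 ≤ K := by simp [hK]
  have hlog2 : 1/2 < Real.log 2 := by linarith [Real.log_two_gt_d9]
  refine ⟨2100 * (2 + 2 * K), by positivity, fun δ hδ hδ1 s hs1 hs2 => ?_⟩
  set T := |s.im| + 2 with hT
  have hT2 : 2 ≤ T := by simp [hT]
  have hlogT : 1/2 < Real.log T := hlog2.trans_le (Real.log_le_log (by norm_num) hT2)
  set c0 : ℂ := 2 + s.im * I with hc0
  set f : ℂ → ℂ := fun w => Z (w + c0) with hf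
  have hfd : Differentiable ℂ f := Z_diff.comp (differentiable_id.add_const c0)
  have hz : s - c0 = ((s.re - 2 : ℝ) : ℂ) := by
    apply Complex.ext <;> simp [hc0]
  have hc0re : c0.re = 2 := by simp [hc0]
  have hf0 : c ≤ ‖f 0‖ := by simpa [hf] using hlow s.im
  have hLdef : Real.exp (2 * Real.log T + K) * c ≥ 32 * T^2 := by
    have e1 : Real.exp (2 * Real.log T + K) = T^2 * Real.exp K := by
      rw [Real.exp_add, mul_comm 2, Real.exp_mul, Real.exp_log (by linarith)]; norm_cast
    have e2 : 32 / c ≤ Real.exp K := by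
      rw [← Real.exp_log (by positivity : 0 < 32 / c), Real.exp_le_exp, hK]
      linarith [le_abs_self (Real.log (32/c))]
    rw [div_le_iff₀ hc] at e2
    rw [e1]
    nlinarith [sq_nonneg T]
  have := landau f hfd (M := 32 * T^2) (L := 2 * Real.log T + K) (δ := δ) (z := s - c0)
    (by linarith) hδ hδ1 ?_ ?_ ?_ ?_ ?_
  · have e1 : deriv f (s - c0) = deriv Z s := by
      simp only [hf]
      rw [deriv_comp_add_const]; simp
    have e2 : f (s - c0) = Z s := by simp [hf]
    rw [e1, e2] at this
    refine this.trans ?_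
    gcongr ?_ / δ
    nlinarith
  · rw [hz, Complex.norm_real, Real.norm_eq_abs, abs_le]; constructor <;> linarith
  · intro w hw
    have h1 : 1/4 ≤ (w + c0).re := by
      have := (abs_le.mp (Complex.abs_re_le_norm w)).1
      rw [Complex.add_re, hc0re]; linarith
    have h2 : ‖w + c0‖ ≤ T + 7/4 := by
      have h3 : ‖c0‖ ≤ T := by
        have := norm_add_le (2:ℂ) (s.im * I)
        simp at this
        rw [hc0, hT]; linarith
      linarith [norm_add_le w c0]
    refine (Z_growth h1).trans ?_
    have h5 : (1 + ‖w + c0‖)^2 ≤ (T + 11/4)^2 := pow_le_pow_left₀ (by positivity) (by linarith) 2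
    nlinarith
  · nlinarith [Real.exp_pos (2 * Real.log T + K)]
  · rw [← norm_pos_iff]; linarith
  · intro w hw hfw
    have h1 := Z_zero_re hRH hfw
    have h2 := Complex.re_le_norm (s - c0 - w)
    simp only [Complex.sub_re, Complex.add_re] at h1 h2
    linarith

end VK


namespace VK

/-- The weight `log(|t|+2)/(1+t^2)`. -/
noncomputable def wt (t : ℝ) : ℝ := Real.log (|t| + 2) / (1 + t^2)

lemma lg_half (t : ℝ) : 1/2 ≤ Real.log (|t| + 2) := by
  have h1 : Real.log 2 ≤ Real.log (|t| + 2) :=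
    Real.log_le_log (by norm_num) (by linarith [abs_nonneg t])
  linarith [Real.log_two_gt_d9]

lemma wt_nonneg (t : ℝ) : 0 ≤ wt t := by
  have := lg_half t
  unfold wt; positivity

lemma wt_le (t : ℝ) : wt t ≤ 4 * (1 + ‖t‖^2) ^ (-(3/2:ℝ)/2) := by
  have hpos : 0 < 1 + t^2 := by positivity
  have h1 : Real.log (|t| + 2) ≤ (|t|+2)^(1/2:ℝ) / (1/2) :=
    Real.log_le_rpow_div (by positivity) (by norm_num)
  have h2 : (|t|+2) ≤ 4 * (1+t^2)^(1/2:ℝ) := by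
    rw [← Real.sqrt_eq_rpow]
    apply le_of_sq_le_sq _ (by positivity)
    rw [mul_pow, Real.sq_sqrt hpos.le]
    have := sq_abs t
    nlinarith [sq_nonneg (|t| - 1), abs_nonneg t]
  have h3 : (|t|+2)^(1/2:ℝ) ≤ 2 * (1+t^2)^(1/4:ℝ) := by
    calc (|t|+2)^(1/2:ℝ) ≤ (4 * (1+t^2)^(1/2:ℝ))^(1/2:ℝ) := by gcongr
      _ = 2 * (1+t^2)^(1/4:ℝ) := by
        rw [Real.mul_rpow (by norm_num) (by positivity), ← Real.rpow_mul hpos.le,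
          ← Real.sqrt_eq_rpow, show (4:ℝ) = 2^2 by norm_num, Real.sqrt_sq (by norm_num)]
        norm_num
  unfold wt
  rw [div_le_iff₀ hpos, Real.norm_eq_abs, sq_abs, mul_assoc]
  have e : (1+t^2)^(-(3/2:ℝ)/2) * (1+t^2) = (1+t^2)^(1/4:ℝ) := by
    rw [← Real.rpow_add_one hpos.ne']; norm_num
  rw [e]
  have h4 : (|t|+2)^(1/2:ℝ) / (1/2) = 2 * (|t|+2)^(1/2:ℝ) := by ring
  linarith

lemma wt_cont : Continuous wt := by
  unfold wt
  refine Continuous.div ?_ (by fun_prop) (fun t => by positivity)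
  exact Continuous.log (by fun_prop) (fun t => by positivity)

lemma wt_integrable : Integrable wt := by
  have h := integrable_rpow_neg_one_add_norm_sq (E := ℝ) (μ := volume) (r := 3/2) (by simp; norm_num)
  refine (h.const_mul 4).mono' wt_cont.aestronglyMeasurable (Eventually.of_forall fun t => ?_)
  rw [Real.norm_of_nonneg (wt_nonneg t)]
  exact wt_le t

lemma wt_tendsto : Tendsto wt atTop (𝓝 0) := by
  have h1 : Tendsto (fun t : ℝ => 1 + ‖t‖^2) atTop atTop := by
    apply tendsto_atTop_add_const_left
    exact (tendsto_pow_atTop (by norm_num)).comp tendsto_norm_atTop_atTop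
  have h2 := ((tendsto_rpow_neg_atTop (by norm_num : (0:ℝ) < 3/2/2)).comp h1).const_mul 4
  rw [mul_zero] at h2
  refine squeeze_zero wt_nonneg (fun t => ?_) h2
  have := wt_le t
  rw [neg_div] at this
  exact this

lemma wt_neg (t : ℝ) : wt (-t) = wt t := by simp [wt]

lemma inv_le_wt (t : ℝ) : 1 / (1 + t^2) ≤ 2 * wt t := by
  have := lg_half t
  unfold wt
  rw [← mul_div_assoc]
  gcongr
  linarith

lemma shift (F : ℂ → ℂ) {a b B : ℝ} (hab : a ≤ b)
    (hF : ∀ s : ℂ, a ≤ s.re → s.re ≤ b → DifferentiableAt ℂ F s)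
    (hB : ∀ s : ℂ, a ≤ s.re → s.re ≤ b → ‖F s‖ ≤ B * wt s.im) :
    ∫ t : ℝ, F (a + t * I) = ∫ t : ℝ, F (b + t * I) := by
  have hvert : ∀ c : ℝ, a ≤ c → c ≤ b → Integrable (fun t : ℝ => F (c + t * I)) := by
    intro c hc1 hc2
    refine (wt_integrable.const_mul B).mono' ?_ (Eventually.of_forall fun t => ?_)
    · refine Continuous.aestronglyMeasurable ?_
      rw [continuous_iff_continuousAt]
      intro t
      have h := (hF (c + t * I) (by simpa using hc1) (by simpa using hc2)).continuousAt
      exact ContinuousAt.comp (g := F) (f := fun t : ℝ => (c + t * I : ℂ)) h (by fun_prop)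
    · simpa using hB (c + t * I) (by simpa using hc1) (by simpa using hc2)
  have hlim : ∀ c : ℝ, a ≤ c → c ≤ b →
      Tendsto (fun T : ℝ => ∫ t in (-T)..T, F (c + t * I)) atTop (𝓝 (∫ t : ℝ, F (c + t * I))) :=
    fun c hc1 hc2 => intervalIntegral_tendsto_integral (hvert c hc1 hc2) tendsto_neg_atTop_atBot tendsto_id
  have hhor : ∀ ε : ℝ, (ε = 1 ∨ ε = -1) → Tendsto (fun T : ℝ => ∫ x in a..b, F (x + ((ε * T : ℝ)) * I)) atTop (𝓝 0) := by
    intro ε hε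
    have h0 : Tendsto (fun T : ℝ => B * wt T * |b - a|) atTop (𝓝 0) := by
      simpa using (wt_tendsto.const_mul B).mul_const |b - a|
    refine squeeze_zero_norm (fun T => ?_) h0
    refine intervalIntegral.norm_integral_le_of_norm_le_const (fun x hx => ?_)
    rw [uIoc_of_le hab] at hx
    have := hB (x + ((ε * T : ℝ)) * I) (by simpa using hx.1.le) (by simpa using hx.2)
    have e : wt (ε * T) = wt T := by
      rcases hε with rfl | rfl
      · rw [one_mul]
      · rw [neg_one_mul, wt_neg]
    simp only [Complex.add_im, Complex.ofReal_im, Complex.mul_im, Complex.ofReal_re, Complex.I_im, mul_one, Complex.I_re, mul_zero, add_zero, zero_add] at this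
    rwa [e] at this
  have hrect : ∀ T : ℝ, (∫ x in a..b, F (x + (((-1) * T : ℝ)) * I)) - (∫ x in a..b, F (x + ((1 * T : ℝ)) * I))
      + I * (∫ t in (-T)..T, F (b + t * I)) - I * (∫ t in (-T)..T, F (a + t * I)) = 0 := by
    intro T
    have := Complex.integral_boundary_rect_eq_zero_of_differentiableOn F (a + (-T : ℝ) * I) (b + T * I) ?_
    · simpa using this
    · intro s hs
      rw [Complex.mem_reProdIm] at hs
      have h1 := hs.1
      simp only [Complex.add_re, Complex.ofReal_re, Complex.mul_re, Complex.I_re, mul_zero, Complex.ofReal_im, Complex.I_im, mul_one, sub_self, add_zero] at h1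
      rw [uIcc_of_le hab] at h1
      exact (hF s h1.1 h1.2).differentiableWithinAt
  have htot := (((hhor (-1) (Or.inr rfl)).sub (hhor 1 (Or.inl rfl))).add ((hlim b hab le_rfl).const_mul I)).sub ((hlim a le_rfl hab).const_mul I)
  have h0 := tendsto_nhds_unique (htot.congr hrect) tendsto_const_nhds
  have : I * (∫ t : ℝ, F (a + t * I)) = I * ∫ t : ℝ, F (b + t * I) := by
    linear_combination -h0
  exact mul_left_cancel₀ Complex.I_ne_zero this

lemma ss_norm {s : ℂ} (hs : 0 < s.re) : ‖s‖^2 ≤ ‖s * (s+1)‖ := by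
  rw [norm_mul, sq]
  gcongr
  rw [← sq_le_sq₀ (norm_nonneg _) (norm_nonneg _), Complex.sq_norm, Complex.sq_norm, Complex.normSq_apply, Complex.normSq_apply]
  simp
  nlinarith

lemma ss_norm_quarter {s : ℂ} (hs : 1/2 ≤ s.re) : (1 + s.im^2)/4 ≤ ‖s * (s+1)‖ := by
  refine le_trans ?_ (ss_norm (by linarith))
  rw [Complex.sq_norm, Complex.normSq_apply]
  nlinarith [sq_nonneg s.im]

lemma line_integrable {G : ℂ → ℂ} {σ B : ℝ} (hc : ∀ t : ℝ, ContinuousAt G (σ + t * I))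
    (hB : ∀ t : ℝ, ‖G (σ + t * I)‖ ≤ B * wt t) : Integrable (fun t : ℝ => G (σ + t * I)) := by
  refine (wt_integrable.const_mul B).mono' ?_ (Eventually.of_forall fun t => hB t)
  refine Continuous.aestronglyMeasurable ?_
  rw [continuous_iff_continuousAt]
  intro t
  exact ContinuousAt.comp (g := G) (f := fun t : ℝ => (σ + t * I : ℂ)) (hc t) (by fun_prop)

lemma kernel_inv {y : ℝ} (hy : 0 < y) :
    ∫ t : ℝ, (y:ℂ) ^ (-((2:ℝ) + t * I : ℂ)) * (1 / (((2:ℝ) + t * I : ℂ) * (((2:ℝ) + t * I : ℂ) + 1)))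
      = 2 * Real.pi * (max (1 - y) 0 : ℝ) := by
  set k : ℝ → ℂ := fun t => indicator (Ioc (0:ℝ) 1) (fun u : ℝ => (u:ℂ)^(0:ℂ)) t - indicator (Ioc (0:ℝ) 1) (fun u : ℝ => (u:ℂ)^(1:ℂ)) t with hk
  have hmel : ∀ s : ℂ, 0 < s.re → HasMellin k s (1 / (s * (s+1))) := by
    intro s hs
    have h0 := hasMellin_cpow_Ioc 0 (s := s) (by simpa using hs)
    have h1 := hasMellin_cpow_Ioc 1 (s := s) (by simp; linarith)
    have h := hasMellin_sub h0.1 h1.1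
    rw [h0.2, h1.2] at h
    have a1 : s ≠ 0 := by rintro rfl; simp at hs
    have a2 : s + 1 ≠ 0 := by
      intro h; have : (s+1).re = 0 := by rw [h]; rfl
      simp at this; linarith
    have e : 1 / (s * (s+1)) = 1 / (s + 0) - 1 / (s + 1) := by
      rw [add_zero]
      field_simp
      ring
    rw [e]
    exact h
  have hkeq : ∀ u : ℝ, 0 < u → k u = ((max (1 - u) 0 : ℝ) : ℂ) := by
    intro u hu
    simp only [hk]
    by_cases h : u ≤ 1
    · have hm : u ∈ Ioc (0:ℝ) 1 := ⟨hu, h⟩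
      rw [indicator_of_mem hm, indicator_of_mem hm, max_eq_left (by linarith)]
      simp
    · rw [indicator_of_notMem (by simp; intro _; linarith), indicator_of_notMem (by simp; intro _; linarith), max_eq_right (by linarith)]
      simp
  have hcont : ContinuousAt k y := by
    have : ContinuousAt (fun u : ℝ => ((max (1 - u) 0 : ℝ) : ℂ)) y := by fun_prop
    refine this.congr ?_
    filter_upwards [lt_mem_nhds hy] with u hu using (hkeq u hu).symm
  have hml : ∀ t : ℝ, mellin k ((2:ℝ) + t * I) = 1 / (((2:ℝ) + t * I : ℂ) * (((2:ℝ) + t * I : ℂ) + 1)) :=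
    fun t => (hmel _ (by simp)).2
  have hintg : Integrable (fun t : ℝ => mellin k ((2:ℝ) + t * I)) := by
    simp_rw [hml]
    refine line_integrable (G := fun s => 1 / (s * (s+1))) (B := 8) (fun t => ?_) (fun t => ?_)
    · have : ((2:ℝ) + t * I : ℂ) * (((2:ℝ) + t * I : ℂ) + 1) ≠ 0 := by
        rw [← norm_pos_iff]
        have := ss_norm_quarter (s := (2:ℝ) + t * I) (by simp; norm_num)
        have h2 : 0 < (1 + ((2:ℝ) + t * I : ℂ).im^2)/4 := by positivity
        linarith
      exact ContinuousAt.div (by fun_prop) (by fun_prop) this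
    · have := ss_norm_quarter (s := (2:ℝ) + t * I) (by simp; norm_num)
      have h2 : ((2:ℝ) + t * I : ℂ).im = t := by simp
      rw [h2] at this
      rw [norm_div, norm_one]
      have h3 : 0 < (1 + t^2)/4 := by positivity
      calc 1 / ‖((2:ℝ) + t * I : ℂ) * (((2:ℝ) + t * I : ℂ) + 1)‖ ≤ 1 / ((1+t^2)/4) := by gcongr
        _ = 4 * (1 / (1+t^2)) := by field_simp
        _ ≤ 8 * wt t := by linarith [inv_le_wt t]
  have hinv := mellinInv_mellin_eq 2 k hy (hmel (2:ℝ) (by simp)).1 hintg hcont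
  rw [hkeq y hy, mellinInv] at hinv
  simp_rw [hml] at hinv
  rw [← hinv]
  simp only [smul_eq_mul, Complex.real_smul]
  have hpi : (Real.pi : ℂ) ≠ 0 := by exact_mod_cast Real.pi_ne_zero
  rw [← mul_assoc]
  have e : (2 * (Real.pi:ℂ)) * (1 / (2 * (Real.pi:ℂ))) = 1 := by
    field_simp
  simp only [Complex.ofReal_div, Complex.ofReal_one, Complex.ofReal_mul, Complex.ofReal_ofNat, e, one_mul]

lemma kernel_inv2 {y : ℝ} (hy : 0 < y) (hy1 : y < 1) :
    ∫ t : ℝ, (y:ℂ) ^ (-((2:ℝ) + t * I : ℂ)) * (1 / (((2:ℝ) + t * I : ℂ) - 1) * (1 / (((2:ℝ) + t * I : ℂ) * (((2:ℝ) + t * I : ℂ) + 1))))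
      = 2 * Real.pi * ((1 - y)^2 / (2 * y) : ℝ) := by
  set k : ℝ → ℂ := fun t => ((1/2:ℂ) • indicator (Ioc (0:ℝ) 1) (fun u : ℝ => (u:ℂ)^(-1:ℂ)) t - indicator (Ioc (0:ℝ) 1) (fun u : ℝ => (u:ℂ)^(0:ℂ)) t) + (1/2:ℂ) • indicator (Ioc (0:ℝ) 1) (fun u : ℝ => (u:ℂ)^(1:ℂ)) t with hk
  have hmel : ∀ s : ℂ, 1 < s.re → HasMellin k s (1 / (s - 1) * (1 / (s * (s+1)))) := by
    intro s hs
    have hm := hasMellin_cpow_Ioc (-1) (s := s) (by simpa using hs)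
    have h0 := hasMellin_cpow_Ioc 0 (s := s) (by simp; linarith)
    have h1 := hasMellin_cpow_Ioc 1 (s := s) (by simp; linarith)
    have hm' := hasMellin_const_smul hm.1 (1/2:ℂ)
    have h1' := hasMellin_const_smul h1.1 (1/2:ℂ)
    have hsub := hasMellin_sub hm'.1 h0.1
    have h := hasMellin_add hsub.1 h1'.1
    rw [hsub.2, h1'.2, hm'.2, h0.2, h1.2, hm.2] at h
    have a1 : s ≠ 0 := by
      intro h; have : s.re = 0 := by rw [h]; rfl
      linarith
    have a2 : s + 1 ≠ 0 := by
      intro h; have : (s+1).re = 0 := by rw [h]; rfl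
      simp at this; linarith
    have a3 : s - 1 ≠ 0 := by
      intro h; have : (s-1).re = 0 := by rw [h]; rfl
      simp at this; linarith
    have e : 1 / (s - 1) * (1 / (s * (s+1))) =
        ((1/2:ℂ) • (1 / (s + -1)) - 1 / (s + 0)) + (1/2:ℂ) • (1 / (s + 1)) := by
      rw [add_zero, ← sub_eq_add_neg, smul_eq_mul, smul_eq_mul]
      field_simp
      ring
    rw [e]
    exact h
  have hkeq : ∀ u : ℝ, 0 < u → u < 1 → k u = (((1 - u)^2/(2*u) : ℝ) : ℂ) := by
    intro u hu h
    simp only [hk]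
    have hm : u ∈ Ioc (0:ℝ) 1 := ⟨hu, h.le⟩
    rw [indicator_of_mem hm, indicator_of_mem hm, indicator_of_mem hm]
    have : (u:ℂ) ≠ 0 := by exact_mod_cast hu.ne'
    rw [Complex.cpow_neg_one, Complex.cpow_zero, Complex.cpow_one]
    push_cast
    simp only [smul_eq_mul]
    field_simp
    ring
  have hcont : ContinuousAt k y := by
    have : ContinuousAt (fun u : ℝ => (((1 - u)^2/(2*u) : ℝ) : ℂ)) y := by
      refine Complex.continuous_ofReal.continuousAt.comp ?_
      exact ContinuousAt.div (by fun_prop) (by fun_prop) (by positivity)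
    refine this.congr ?_
    filter_upwards [lt_mem_nhds hy, gt_mem_nhds hy1] with u hu hu1 using (hkeq u hu hu1).symm
  have hml : ∀ t : ℝ, mellin k ((2:ℝ) + t * I) = 1 / (((2:ℝ) + t * I : ℂ) - 1) * (1 / (((2:ℝ) + t * I : ℂ) * (((2:ℝ) + t * I : ℂ) + 1))) :=
    fun t => (hmel _ (by simp)).2
  have hintg : Integrable (fun t : ℝ => mellin k ((2:ℝ) + t * I)) := by
    simp_rw [hml]
    have hone : ∀ t : ℝ, 1 ≤ ‖((2:ℝ) + t * I : ℂ) - 1‖ := by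
      intro t
      have := Complex.re_le_norm (((2:ℝ) + t * I : ℂ) - 1)
      simp at this ⊢; linarith
    refine line_integrable (G := fun s => 1 / (s-1) * (1 / (s * (s+1)))) (B := 8) (fun t => ?_) (fun t => ?_)
    · have : ((2:ℝ) + t * I : ℂ) * (((2:ℝ) + t * I : ℂ) + 1) ≠ 0 := by
        rw [← norm_pos_iff]
        have := ss_norm_quarter (s := (2:ℝ) + t * I) (by simp; norm_num)
        have h2 : 0 < (1 + ((2:ℝ) + t * I : ℂ).im^2)/4 := by positivity
        linarith
      refine ContinuousAt.mul (ContinuousAt.div (by fun_prop) (by fun_prop) ?_) (ContinuousAt.div (by fun_prop) (by fun_prop) this)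
      rw [← norm_pos_iff]; linarith [hone t]
    · have := ss_norm_quarter (s := (2:ℝ) + t * I) (by simp; norm_num)
      have h2 : ((2:ℝ) + t * I : ℂ).im = t := by simp
      rw [h2] at this
      rw [norm_mul, norm_div, norm_div, norm_one]
      have h3 : 0 < (1 + t^2)/4 := by positivity
      have h4 : 1 / ‖((2:ℝ) + t * I : ℂ) - 1‖ ≤ 1 := by
        rw [div_le_one (by linarith [hone t])]; exact hone t
      calc _ ≤ 1 * (1 / ((1+t^2)/4)) := by gcongr
        _ = 4 * (1 / (1+t^2)) := by field_simp
        _ ≤ 8 * wt t := by linarith [inv_le_wt t]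
  have hinv := mellinInv_mellin_eq 2 k hy (hmel (2:ℝ) (by simp)).1 hintg hcont
  rw [hkeq y hy hy1, mellinInv] at hinv
  simp_rw [hml] at hinv
  rw [← hinv]
  simp only [smul_eq_mul, Complex.real_smul]
  have hpi : (Real.pi : ℂ) ≠ 0 := by exact_mod_cast Real.pi_ne_zero
  rw [← mul_assoc]
  have e : (2 * (Real.pi:ℂ)) * (1 / (2 * (Real.pi:ℂ))) = 1 := by
    field_simp
  simp only [Complex.ofReal_div, Complex.ofReal_one, Complex.ofReal_mul, Complex.ofReal_ofNat, e, one_mul]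

end VK


namespace VK
open ArithmeticFunction in
lemma hasSum_logDeriv {s : ℂ} (hs : 1 < s.re) :
    HasSum (fun n : ℕ => LSeries.term (fun n => (vonMangoldt n : ℂ)) s n)
      (-(deriv Z s / Z s) + 1 / (s - 1)) := by
  have h1 := (LSeriesSummable_vonMangoldt hs).hasSum
  have h2 := LSeries_vonMangoldt_eq_deriv_riemannZeta_div hs
  have hne : s ≠ 1 := by rintro rfl; simp at hs
  have hz : riemannZeta s ≠ 0 := riemannZeta_ne_zero_of_one_lt_re hs
  have hd : deriv Z s = riemannZeta s + (s - 1) * deriv riemannZeta s := by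
    have e : Z =ᶠ[𝓝 s] fun s => (s - 1) * riemannZeta s := by
      filter_upwards [isOpen_ne.mem_nhds hne] with z hz using Z_ne hz
    rw [e.deriv_eq]
    have := ((hasDerivAt_id s).sub_const 1).mul (differentiableAt_riemannZeta hne).hasDerivAt
    have h := this.deriv
    simp only [id_eq, one_mul] at h
    exact h
  have e : -(deriv Z s / Z s) + 1 / (s - 1) = - deriv riemannZeta s / riemannZeta s := by
    rw [hd, Z_ne hne]
    have : s - 1 ≠ 0 := sub_ne_zero.mpr hne
    field_simp
    ring
  rw [e, ← h2]
  exact h1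

/-- The kernel `X^(s+1)/(s(s+1))`. -/
noncomputable def Ker (X : ℝ) (s : ℂ) : ℂ := (X:ℂ)^(s+1) / (s * (s+1))

lemma ss_ne {s : ℂ} (hs : 1/2 ≤ s.re) : s * (s+1) ≠ 0 := by
  rw [← norm_pos_iff]
  have := ss_norm_quarter hs
  have h2 : 0 < (1 + s.im^2)/4 := by positivity
  linarith

lemma Ker_norm {X : ℝ} (hX : 0 < X) {s : ℂ} (hs : 1/2 ≤ s.re) :
    ‖Ker X s‖ ≤ 4 * X^(s.re+1) / (1 + s.im^2) := by
  unfold Ker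
  rw [norm_div, Complex.norm_cpow_eq_rpow_re_of_pos hX]
  have h := ss_norm_quarter hs
  have h2 : 0 < (1 + s.im^2)/4 := by positivity
  have : (s+1).re = s.re + 1 := by simp
  rw [this]
  calc _ ≤ X^(s.re+1) / ((1 + s.im^2)/4) := by gcongr
    _ = _ := by field_simp

lemma Ker_diff {X : ℝ} (hX : 0 < X) {s : ℂ} (hs : 1/2 ≤ s.re) : DifferentiableAt ℂ (Ker X) s := by
  unfold Ker
  refine DifferentiableAt.div ?_ (by fun_prop) (ss_ne hs)
  refine DifferentiableAt.const_cpow (by fun_prop) (Or.inl ?_)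
  exact_mod_cast hX.ne'

lemma two_re (t : ℝ) : ((2:ℝ) + t * I : ℂ).re = 2 := by simp
lemma two_im (t : ℝ) : ((2:ℝ) + t * I : ℂ).im = t := by simp

lemma Ker_two_norm {X : ℝ} (hX : 0 < X) (t : ℝ) :
    ‖Ker X ((2:ℝ) + t * I)‖ ≤ 8 * X^(3:ℝ) * wt t := by
  have h := Ker_norm hX (s := (2:ℝ) + t * I) (by rw [two_re]; norm_num)
  rw [two_re, two_im] at h
  have := inv_le_wt t
  calc _ ≤ 4 * X^(2+1:ℝ) / (1 + t^2) := h
    _ = 4 * X^(3:ℝ) * (1 / (1 + t^2)) := by norm_num; ring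
    _ ≤ 4 * X^(3:ℝ) * (2 * wt t) := by gcongr
    _ = _ := by ring

lemma Ker_pow {X y : ℝ} (hX : 0 < X) (hy : 0 < y) (s : ℂ) :
    (1 / (y:ℂ)^s) * Ker X s = X * (((y / X : ℝ) : ℂ)^(-s) * (1 / (s * (s+1)))) := by
  unfold Ker
  have hX' : (X:ℂ) ≠ 0 := by exact_mod_cast hX.ne'
  have hy' : (y:ℂ) ≠ 0 := by exact_mod_cast hy.ne'
  have e : (X:ℂ) ^ (s+1) = X ^ s * X := by rw [Complex.cpow_add _ _ hX', Complex.cpow_one]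
  rw [e, div_eq_mul_inv y X, Complex.ofReal_mul, Complex.mul_cpow_ofReal_nonneg hy.le (by positivity), Complex.ofReal_inv,
    Complex.inv_cpow _ _ (by rw [Complex.arg_ofReal_of_nonneg hX.le]; exact Real.pi_pos.ne), Complex.cpow_neg, Complex.cpow_neg, inv_inv]
  ring

open ArithmeticFunction in
lemma int_term {X : ℝ} (hX : 0 < X) (n : ℕ) :
    ∫ t : ℝ, LSeries.term (fun n => (vonMangoldt n : ℂ)) ((2:ℝ) + t * I) n * Ker X ((2:ℝ) + t * I)
     = ((2 * Real.pi * (vonMangoldt n * max (X - n) 0) : ℝ) : ℂ) := by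
  rcases eq_or_ne n 0 with rfl | hn
  · simp
  have hn' : (0:ℝ) < n := by exact_mod_cast Nat.pos_of_ne_zero hn
  have e : ∀ t : ℝ, LSeries.term (fun n => (vonMangoldt n : ℂ)) ((2:ℝ) + t * I) n * Ker X ((2:ℝ) + t * I)
     = (vonMangoldt n * X : ℂ) * (((n / X : ℝ) : ℂ)^(-((2:ℝ) + t * I : ℂ)) * (1 / (((2:ℝ) + t * I : ℂ) * (((2:ℝ) + t * I : ℂ)+1)))) := by
    intro t
    rw [LSeries.term_of_ne_zero hn, mul_assoc, ← Ker_pow hX hn', Complex.ofReal_natCast]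
    ring
  simp_rw [e]
  rw [MeasureTheory.integral_const_mul, kernel_inv (by positivity)]
  have : max (X - n) 0 = X * max (1 - n / X) 0 := by
    rw [mul_max_of_nonneg _ _ hX.le]
    congr 1
    · field_simp
    · simp
  rw [this]
  push_cast
  ring

lemma int_pole {X : ℝ} (hX : 1 < X) :
    ∫ t : ℝ, 1 / (((2:ℝ) + t * I : ℂ) - 1) * Ker X ((2:ℝ) + t * I)
     = ((2 * Real.pi * ((X - 1)^2/2) : ℝ) : ℂ) := by
  have hX0 : 0 < X := by linarith
  have e : ∀ t : ℝ, 1 / (((2:ℝ) + t * I : ℂ) - 1) * Ker X ((2:ℝ) + t * I)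
     = (X : ℂ) * (((1 / X : ℝ) : ℂ)^(-((2:ℝ) + t * I : ℂ)) * (1 / (((2:ℝ) + t * I : ℂ) - 1) * (1 / (((2:ℝ) + t * I : ℂ) * (((2:ℝ) + t * I : ℂ)+1))))) := by
    intro t
    have := Ker_pow hX0 one_pos ((2:ℝ) + t * I : ℂ)
    rw [Complex.ofReal_one, Complex.one_cpow, div_one, one_mul] at this
    rw [this]
    ring
  simp_rw [e]
  rw [MeasureTheory.integral_const_mul, kernel_inv2 (by positivity) (by rw [div_lt_one hX0]; exact hX)]
  have : (X - 1)^2/2 = X * ((1 - 1/X)^2 / (2 * (1/X))) := by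
    field_simp
  rw [this]
  push_cast
  ring

lemma hone (t : ℝ) : 1 ≤ ‖((2:ℝ) + t * I : ℂ) - 1‖ := by
  have := Complex.re_le_norm (((2:ℝ) + t * I : ℂ) - 1)
  simp at this ⊢; linarith

lemma Z_ne_zero (hRH : RiemannHypothesis) {s : ℂ} (hs : 1/2 < s.re) : Z s ≠ 0 := by
  intro h
  have := Z_zero_re hRH h
  linarith

lemma LD_diff (hRH : RiemannHypothesis) {s : ℂ} (hs : 1/2 < s.re) :
    DifferentiableAt ℂ (fun s => deriv Z s / Z s) s :=
  ((Z_diff.deriv) s).div (Z_diff s) (Z_ne_zero hRH hs)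

open ArithmeticFunction in
lemma explicit (hRH : RiemannHypothesis) {X : ℝ} (hX : 1 < X) :
    Integrable (fun t : ℝ => -(deriv Z ((2:ℝ) + t * I) / Z ((2:ℝ) + t * I)) * Ker X ((2:ℝ) + t * I)) ∧
    HasSum (fun n : ℕ => ((2 * Real.pi * (vonMangoldt n * max (X - n) 0) : ℝ) : ℂ))
      ((∫ t : ℝ, -(deriv Z ((2:ℝ) + t * I) / Z ((2:ℝ) + t * I)) * Ker X ((2:ℝ) + t * I)) +
        ((2 * Real.pi * ((X - 1)^2/2) : ℝ) : ℂ)) := by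
  have hX0 : 0 < X := by linarith
  have hKc : ∀ t : ℝ, ContinuousAt (Ker X) ((2:ℝ) + t * I) := fun t =>
    (Ker_diff hX0 (by rw [two_re]; norm_num)).continuousAt
  obtain ⟨C, hC, hLD⟩ := Z_logDeriv hRH
  have i1 : Integrable (fun t : ℝ => -(deriv Z ((2:ℝ) + t * I) / Z ((2:ℝ) + t * I)) * Ker X ((2:ℝ) + t * I)) := by
    refine line_integrable (G := fun s => -(deriv Z s / Z s) * Ker X s) (B := C * (4 * X^(3:ℝ))) (fun t => ?_) (fun t => ?_)
    · exact (LD_diff hRH (by rw [two_re]; norm_num)).continuousAt.neg.mul (hKc t)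
    · have h1 := hLD 1 one_pos le_rfl ((2:ℝ) + t * I) (by rw [two_re]; norm_num) (by rw [two_re])
      have h2 := Ker_norm hX0 (s := (2:ℝ) + t * I) (by rw [two_re]; norm_num)
      rw [two_im] at h1
      rw [two_re, two_im] at h2
      rw [norm_mul, norm_neg]
      calc _ ≤ (C * Real.log (|t| + 2) / 1) * (4 * X^(2+1:ℝ) / (1 + t^2)) := by
            have := lg_half t
            gcongr
        _ = _ := by unfold wt; norm_num; ring
  have i2 : Integrable (fun t : ℝ => 1 / (((2:ℝ) + t * I : ℂ) - 1) * Ker X ((2:ℝ) + t * I)) := by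
    refine line_integrable (G := fun s => 1 / (s - 1) * Ker X s) (B := 8 * X^(3:ℝ)) (fun t => ?_) (fun t => ?_)
    · refine ContinuousAt.mul (ContinuousAt.div (by fun_prop) (by fun_prop) ?_) (hKc t)
      rw [← norm_pos_iff]; linarith [hone t]
    · rw [norm_mul, norm_div, norm_one]
      have h4 : 1 / ‖((2:ℝ) + t * I : ℂ) - 1‖ ≤ 1 := by
        rw [div_le_one (by linarith [hone t])]; exact hone t
      have := Ker_two_norm hX0 t
      calc _ ≤ 1 * (8 * X^(3:ℝ) * wt t) := by gcongr
        _ = _ := one_mul _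
  refine ⟨i1, ?_⟩
  have hnorm : ∀ (n : ℕ) (t : ℝ), ‖LSeries.term (fun n => (vonMangoldt n : ℂ)) ((2:ℝ) + t * I) n‖ = ‖LSeries.term (fun n => (vonMangoldt n : ℂ)) 2 n‖ := by
    intro n t
    rw [LSeries.norm_term_eq, LSeries.norm_term_eq, two_re]
    norm_num
  have hterm : ∀ n : ℕ, ∀ t : ℝ, ‖LSeries.term (fun n => (vonMangoldt n : ℂ)) ((2:ℝ) + t * I) n * Ker X ((2:ℝ) + t * I)‖ ≤ (‖LSeries.term (fun n => (vonMangoldt n : ℂ)) 2 n‖ * (8 * X^(3:ℝ))) * wt t := by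
    intro n t
    rw [norm_mul, hnorm, mul_assoc]
    gcongr
    exact Ker_two_norm hX0 t
  have iF : ∀ n : ℕ, Integrable (fun t : ℝ => LSeries.term (fun n => (vonMangoldt n : ℂ)) ((2:ℝ) + t * I) n * Ker X ((2:ℝ) + t * I)) := by
    intro n
    refine line_integrable (G := fun s => LSeries.term (fun n => (vonMangoldt n : ℂ)) s n * Ker X s) (fun t => ?_) (hterm n)
    refine ContinuousAt.mul ?_ (hKc t)
    rcases eq_or_ne n 0 with rfl | hn
    · simp only [LSeries.term_zero]; fun_prop
    · simp only [LSeries.term_of_ne_zero hn]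
      have hn' : (n:ℂ) ≠ 0 := by exact_mod_cast hn
      refine ContinuousAt.div (by fun_prop) ?_ ?_
      · exact ContinuousAt.const_cpow (by fun_prop) (Or.inl hn')
      · rw [Complex.cpow_ne_zero_iff]; exact Or.inl hn'
  have hsum : Summable fun n : ℕ => ∫ t : ℝ, ‖LSeries.term (fun n => (vonMangoldt n : ℂ)) ((2:ℝ) + t * I) n * Ker X ((2:ℝ) + t * I)‖ := by
    have h2 : Summable fun n : ℕ => ‖LSeries.term (fun n => (vonMangoldt n : ℂ)) 2 n‖ :=
      (LSeriesSummable_vonMangoldt (s := 2) (by norm_num)).norm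
    refine Summable.of_nonneg_of_le (fun n => by positivity) (fun n => ?_) ((h2.mul_right (8 * X^(3:ℝ))).mul_right (∫ t, wt t))
    rw [← MeasureTheory.integral_const_mul]
    exact integral_mono (iF n).norm (wt_integrable.const_mul _) (hterm n)
  have hS := hasSum_integral_of_summable_integral_norm iF hsum
  simp_rw [int_term hX0] at hS
  suffices e : ((∫ t : ℝ, -(deriv Z ((2:ℝ) + t * I) / Z ((2:ℝ) + t * I)) * Ker X ((2:ℝ) + t * I)) +
        ((2 * Real.pi * ((X - 1)^2/2) : ℝ) : ℂ)) = ∫ (t : ℝ), ∑' (n : ℕ), LSeries.term (fun n => (vonMangoldt n : ℂ)) ((2:ℝ) + t * I) n * Ker X ((2:ℝ) + t * I) by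
    rw [e]; exact hS
  rw [← int_pole hX, ← integral_add i1 i2]
  refine integral_congr_ae (Eventually.of_forall fun t => ?_)
  have := hasSum_logDeriv (s := (2:ℝ) + t * I) (by rw [two_re]; norm_num)
  simp only
  rw [tsum_mul_right, this.tsum_eq]
  ring
end VK


namespace VK

lemma re_two_mul (z : ℂ) : (2 * z).re = 2 * z.re := by simp

lemma hasSum_val {f : ℕ → ℝ} {a b : ℝ} (h : HasSum f a) (e : b = a) : HasSum f b := e ▸ h

/-- Second difference of the kernel. -/
noncomputable def Kern (x h : ℝ) (s : ℂ) : ℂ := Ker (x+h) s - 2 * Ker x s + Ker (x-h) s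

lemma kern_bound1 {x h : ℝ} (hh : 0 < h) (hx : h ≤ x/2) {s : ℂ} (h1 : 1/2 ≤ s.re) (h2 : s.re ≤ 1) :
    ‖Kern x h s‖ ≤ 4 * h^2 * x^(s.re - 1) := by
  have hx0 : 0 < x := by linarith
  have s0 : s ≠ 0 := by intro e; rw [e] at h1; simp at h1; linarith
  have s1 : s + 1 ≠ 0 := by
    intro e
    have : (s+1).re = 0 := by rw [e]; rfl
    simp at this; linarith
  have d1 : ∀ u : ℝ, 0 < u → HasDerivAt (fun u : ℝ => Ker u s) ((u:ℂ)^s / s) u := by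
    intro u hu
    have := (hasDerivAt_ofReal_cpow_const' hu.ne' (r := s) (by intro e; apply s1; rw [e]; ring)).div_const s
    refine this.congr_of_eventuallyEq (Eventually.of_forall fun v => ?_)
    unfold Ker
    simp only
    rw [div_div, mul_comm s]
  have d2 : ∀ u : ℝ, 0 < u → HasDerivAt (fun u : ℝ => (u:ℂ)^s / s) ((u:ℂ)^(s-1)) u := by
    intro u hu
    have := (hasDerivAt_ofReal_cpow_const' hu.ne' (r := s-1) (by intro e; apply s0; linear_combination e))
    simpa using this
  set M : ℝ := (x/2)^(s.re-1) with hM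
  have hM0 : 0 ≤ M := by positivity
  have hMx : M ≤ 2 * x^(s.re-1) := by
    rw [hM, Real.div_rpow hx0.le (by norm_num), div_eq_mul_inv, ← Real.rpow_neg (by norm_num), mul_comm]
    gcongr
    calc (2:ℝ)^(-(s.re-1)) ≤ 2^(1:ℝ) := by
          apply Real.rpow_le_rpow_of_exponent_le <;> linarith
      _ = 2 := by norm_num
  have step1 : ∀ v ∈ Icc 0 h, ‖((x+v:ℝ):ℂ)^s / s - ((x-v:ℝ):ℂ)^s / s‖ ≤ 2 * M * h := by
    intro v hv
    have := Convex.norm_image_sub_le_of_norm_hasDerivWithin_le (f := fun u : ℝ => (u:ℂ)^s / s) (f' := fun u : ℝ => (u:ℂ)^(s-1)) (C := M) (s := Ici (x/2)) (x := x - v) (y := x + v)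
      (fun u hu => (d2 u (by have := mem_Ici.1 hu; linarith)).hasDerivWithinAt) (fun u hu => ?_) (convex_Ici _) (by simp; linarith [hv.2]) (by simp; linarith [hv.1])
    · refine this.trans ?_
      rw [Real.norm_eq_abs, abs_of_nonneg (by linarith [hv.1])]
      nlinarith [hv.1, hv.2]
    · have hu' := mem_Ici.1 hu
      rw [Complex.norm_cpow_eq_rpow_re_of_pos (by linarith)]
      simp only [Complex.sub_re, Complex.one_re]
      exact Real.rpow_le_rpow_of_nonpos (by linarith) hu' (by linarith)
  have step2 := Convex.norm_image_sub_le_of_norm_hasDerivWithin_le (f := fun v : ℝ => Ker (x+v) s + Ker (x-v) s) (f' := fun v : ℝ => ((x+v:ℝ):ℂ)^s / s - ((x-v:ℝ):ℂ)^s / s) (C := 2*M*h) (s := Icc 0 h) (x := 0) (y := h)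
      (fun v hv => ?_) step1 (convex_Icc _ _) (by simp; linarith) (by simp; linarith)
  · have e : Kern x h s = (Ker (x+h) s + Ker (x-h) s) - (Ker (x+0) s + Ker (x-0) s) := by
      unfold Kern; rw [add_zero, sub_zero]; ring
    rw [e]
    refine step2.trans ?_
    rw [Real.norm_eq_abs, sub_zero, abs_of_pos hh]
    calc 2 * M * h * h = 2 * h^2 * M := by ring
      _ ≤ 2 * h^2 * (2 * x^(s.re-1)) := by gcongr
      _ = _ := by ring
  · have a1 : HasDerivAt (fun v : ℝ => Ker (x+v) s) (((x+v:ℝ):ℂ)^s / s) v := by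
      have := (d1 (x+v) (by linarith [hv.1])).scomp v ((hasDerivAt_id v).const_add x)
      simpa [Function.comp_def] using this
    have a2 : HasDerivAt (fun v : ℝ => Ker (x-v) s) (-(((x-v:ℝ):ℂ)^s / s)) v := by
      have := (d1 (x-v) (by linarith [hv.2])).scomp v ((hasDerivAt_id v).const_sub x)
      simpa [Function.comp_def] using this
    have := a1.add a2
    rw [← sub_eq_add_neg] at this
    exact this.hasDerivWithinAt

lemma kern_bound2 {x h : ℝ} (hh : 0 < h) (hx : h ≤ x/2) {s : ℂ} (h1 : 1/2 ≤ s.re) :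
    ‖Kern x h s‖ ≤ 16 * (2*x)^(s.re + 1) / (1 + s.im^2) := by
  have key : ∀ X : ℝ, 0 < X → X ≤ 2*x → ‖Ker X s‖ ≤ 4 * (2*x)^(s.re+1) / (1 + s.im^2) := by
    intro X hX hX2
    refine (Ker_norm hX h1).trans ?_
    gcongr
  have k1 := key (x+h) (by linarith) (by linarith)
  have k2 := key x (by linarith) (by linarith)
  have k3 := key (x-h) (by linarith) (by linarith)
  unfold Kern
  calc _ ≤ ‖Ker (x+h) s‖ + ‖2 * Ker x s‖ + ‖Ker (x-h) s‖ :=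
        (norm_add_le _ _).trans (by gcongr; exact norm_sub_le _ _)
    _ = ‖Ker (x+h) s‖ + 2 * ‖Ker x s‖ + ‖Ker (x-h) s‖ := by rw [norm_mul]; norm_num
    _ ≤ 4 * (4 * (2*x)^(s.re+1) / (1 + s.im^2)) := by linarith
    _ = _ := by ring

lemma kern_bound {x h : ℝ} (hh : 0 < h) (hx : h ≤ x/2) {s : ℂ} (h1 : 1/2 ≤ s.re) (h2 : s.re ≤ 1) :
    ‖Kern x h s‖ ≤ 68 * x^(s.re + 1) * (h/x)^2 / (1 + (h/x * s.im)^2) := by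
  have hx0 : 0 < x := by linarith
  have b1 := kern_bound1 hh hx h1 h2
  have b2 := kern_bound2 hh hx h1
  have e1 : x^(s.re+1) = x^(s.re-1) * x^2 := by
    rw [← Real.rpow_natCast, ← Real.rpow_add hx0]; congr 1; push_cast; ring
  have e2 : (2*x)^(s.re+1) ≤ 4 * x^(s.re+1) := by
    rw [Real.mul_rpow (by norm_num) hx0.le]
    gcongr
    calc (2:ℝ)^(s.re+1) ≤ 2^(2:ℝ) := by
          apply Real.rpow_le_rpow_of_exponent_le <;> linarith
      _ = 4 := by norm_num
  have b1' : ‖Kern x h s‖ ≤ 4 * x^(s.re+1) * (h/x)^2 := by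
    refine b1.trans (le_of_eq ?_)
    rw [e1]; field_simp
  have b2' : ‖Kern x h s‖ * s.im^2 ≤ 64 * x^(s.re+1) := by
    rw [le_div_iff₀ (by positivity)] at b2
    nlinarith [norm_nonneg (Kern x h s)]
  rw [le_div_iff₀ (by positivity)]
  have : ‖Kern x h s‖ * (h/x * s.im)^2 ≤ 64 * x^(s.re+1) * (h/x)^2 := by
    calc _ = ‖Kern x h s‖ * s.im^2 * (h/x)^2 := by ring
      _ ≤ _ := by gcongr
  linarith

lemma Kern_diff {x h : ℝ} (hh : 0 < h) (hx : h ≤ x/2) {s : ℂ} (hs : 1/2 ≤ s.re) :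
    DifferentiableAt ℂ (Kern x h) s := by
  unfold Kern
  exact ((Ker_diff (by linarith) hs).sub ((Ker_diff (by linarith) hs).const_mul 2)).add (Ker_diff (by linarith) hs)

lemma log_wt {ε ℓ t : ℝ} (h0 : 0 < ε) (h1 : ε ≤ 1) (hℓ : 1 ≤ ℓ) (hε : -Real.log ε ≤ ℓ) :
    Real.log (|t| + 2) / (1 + (ε * t)^2) ≤ 3 * ℓ * wt (ε * t) := by
  have a : Real.log (|t| + 2) ≤ Real.log (|ε * t| + 2) + ℓ := by
    have : |t| + 2 ≤ (|ε * t| + 2) / ε := by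
      rw [le_div_iff₀ h0, abs_mul, abs_of_pos h0]; nlinarith
    have h3 := Real.log_le_log (by positivity) this
    rw [Real.log_div (by positivity) h0.ne'] at h3
    linarith
  have b := lg_half (ε * t)
  have c : Real.log (|t| + 2) ≤ 3 * ℓ * Real.log (|ε * t| + 2) := by nlinarith
  unfold wt
  rw [← mul_div_assoc]
  gcongr

lemma int_bound (hRH : RiemannHypothesis) : ∃ C > 0, ∀ x h : ℝ, Real.exp 2 ≤ x → 1 ≤ h → h ≤ x/2 →
    ‖∫ t : ℝ, -(deriv Z ((2:ℝ) + t * I) / Z ((2:ℝ) + t * I)) * Kern x h ((2:ℝ) + t * I)‖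
      ≤ C * (h * Real.sqrt x * Real.log x^2) := by
  obtain ⟨C, hC, hLD⟩ := Z_logDeriv hRH
  have hW : 0 ≤ ∫ t, wt t := integral_nonneg wt_nonneg
  refine ⟨612 * C * (∫ t, wt t) + 1, by positivity, fun x h hx hh hhx => ?_⟩
  have hx0 : 0 < x := lt_of_lt_of_le (Real.exp_pos _) hx
  have hx1 : 1 ≤ x := by linarith
  have hℓ : 2 ≤ Real.log x := by rwa [Real.le_log_iff_exp_le hx0]
  set ℓ := Real.log x with hℓdef
  set δ := 1/ℓ with hδ
  have hδ0 : 0 < δ := by positivity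
  have hδ1 : δ ≤ 1/2 := by rw [hδ]; gcongr
  set σ : ℝ := 1/2 + δ with hσ
  set F : ℂ → ℂ := fun s => -(deriv Z s / Z s) * Kern x h s with hF
  have hsh : ∫ t : ℝ, F (σ + t * I) = ∫ t : ℝ, F ((2:ℝ) + t * I) := by
    refine shift F (B := C / δ * (16 * (2*x)^(3:ℝ))) (by linarith) (fun s h1 h2 => ?_) (fun s h1 h2 => ?_)
    · exact (LD_diff hRH (by linarith)).neg.mul (Kern_diff (by linarith) hhx (by linarith))
    · have b1 := hLD δ hδ0 (by linarith) s h1 h2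
      have b2 := kern_bound2 (by linarith) hhx (s := s) (by linarith)
      have b3 : (2*x)^(s.re+1) ≤ (2*x)^(3:ℝ) := Real.rpow_le_rpow_of_exponent_le (by linarith) (by linarith)
      have := lg_half s.im
      rw [hF]
      simp only
      rw [norm_mul, norm_neg]
      calc _ ≤ (C * Real.log (|s.im| + 2) / δ) * (16 * (2*x)^(3:ℝ) / (1 + s.im^2)) := by
            gcongr
            exact b2.trans (by gcongr)
        _ = _ := by unfold wt; ring
  change ‖∫ t : ℝ, F ((2:ℝ) + t * I)‖ ≤ _
  rw [← hsh]
  set ε := h/x with hε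
  have hε0 : 0 < ε := by positivity
  have hε1 : ε ≤ 1 := by rw [hε, div_le_one hx0]; linarith
  have hεl : -Real.log ε ≤ ℓ := by
    rw [hε, Real.log_div (by linarith) hx0.ne']
    linarith [Real.log_nonneg hh]
  have hxσ : x^σ ≤ 3 * Real.sqrt x := by
    rw [hσ, Real.rpow_add hx0, ← Real.sqrt_eq_rpow, mul_comm]
    gcongr
    rw [Real.rpow_def_of_pos hx0, hδ, ← hℓdef, mul_one_div_cancel (by positivity)]
    linarith [Real.exp_one_lt_d9]
  have hbd : ∀ t : ℝ, ‖F (σ + t * I)‖ ≤ (612 * C * Real.sqrt x * ℓ^2 * h * ε) * wt (ε * t) := by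
    intro t
    have hre : (σ + t * I : ℂ).re = σ := by simp
    have him : (σ + t * I : ℂ).im = t := by simp
    have b1 := hLD δ hδ0 (by linarith) (σ + t * I) (by rw [hre]) (by rw [hre]; linarith)
    have b2 := kern_bound (by linarith) hhx (s := σ + t * I) (by rw [hre]; linarith) (by rw [hre]; linarith)
    have b3 := log_wt (t := t) hε0 hε1 (by linarith) hεl
    rw [hre, him] at b2
    rw [him] at b1
    have := lg_half t
    have hw := wt_nonneg (ε * t)
    rw [hF]
    simp only
    rw [norm_mul, norm_neg]
    calc _ ≤ (C * Real.log (|t| + 2) / δ) * (68 * x^(σ+1) * ε^2 / (1 + (ε*t)^2)) := by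
          gcongr
      _ = C * ℓ * 68 * x^(σ+1) * ε^2 * (Real.log (|t| + 2) / (1 + (ε*t)^2)) := by
          rw [hδ]; field_simp
      _ ≤ C * ℓ * 68 * x^(σ+1) * ε^2 * (3 * ℓ * wt (ε * t)) := by gcongr
      _ = 204 * C * ℓ^2 * x^σ * h * ε * wt (ε * t) := by
          rw [Real.rpow_add_one hx0.ne', hε]; field_simp; ring
      _ ≤ 204 * C * ℓ^2 * (3 * Real.sqrt x) * h * ε * wt (ε * t) := by gcongr
      _ = _ := by ring
  have hintg : Integrable (fun t => (612 * C * Real.sqrt x * ℓ^2 * h * ε) * wt (ε * t)) :=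
    (wt_integrable.comp_mul_left' hε0.ne').const_mul _
  refine (norm_integral_le_of_norm_le hintg (Eventually.of_forall hbd)).trans ?_
  rw [MeasureTheory.integral_const_mul, Measure.integral_comp_mul_left wt ε, abs_of_pos (by positivity), smul_eq_mul]
  have e : (612 * C * Real.sqrt x * ℓ^2 * h * ε) * (ε⁻¹ * ∫ t, wt t) = (612 * C * ∫ t, wt t) * (h * Real.sqrt x * ℓ^2) := by
    field_simp
  rw [e]
  have : 0 ≤ h * Real.sqrt x * ℓ^2 := by positivity
  nlinarith

open ArithmeticFunction in
lemma tent_bound (hRH : RiemannHypothesis) : ∃ C > 0, ∀ x h : ℝ, Real.exp 2 ≤ x → 1 ≤ h → h ≤ x/2 →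
    ∃ S : ℝ, HasSum (fun n : ℕ => vonMangoldt n * (max (x + h - n) 0 - 2 * max (x - n) 0 + max (x - h - n) 0)) S ∧
      |S - h^2| ≤ C * (h * Real.sqrt x * Real.log x^2) := by
  obtain ⟨C, hC, hB⟩ := int_bound hRH
  refine ⟨C, hC, fun x h hx hh hhx => ?_⟩
  have hx2 : 2 < x := by
    have := Real.add_one_lt_exp (x := 2) (by norm_num)
    linarith
  obtain ⟨i1, s1⟩ := explicit hRH (X := x + h) (by linarith)
  obtain ⟨i2, s2⟩ := explicit hRH (X := x) (by linarith)
  obtain ⟨i3, s3⟩ := explicit hRH (X := x - h) (by linarith)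
  set T := ∫ t : ℝ, -(deriv Z ((2:ℝ) + t * I) / Z ((2:ℝ) + t * I)) * Kern x h ((2:ℝ) + t * I) with hT
  have hTe : T = (∫ t : ℝ, -(deriv Z ((2:ℝ) + t * I) / Z ((2:ℝ) + t * I)) * Ker (x+h) ((2:ℝ) + t * I)) - 2 * (∫ t : ℝ, -(deriv Z ((2:ℝ) + t * I) / Z ((2:ℝ) + t * I)) * Ker x ((2:ℝ) + t * I)) + (∫ t : ℝ, -(deriv Z ((2:ℝ) + t * I) / Z ((2:ℝ) + t * I)) * Ker (x-h) ((2:ℝ) + t * I)) := by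
    rw [← MeasureTheory.integral_const_mul, ← integral_sub i1 (i2.const_mul 2), ← integral_add (by exact i1.sub (i2.const_mul 2)) i3, hT]
    refine integral_congr_ae (Eventually.of_forall fun t => ?_)
    simp only [Kern]
    ring
  generalize (∫ t : ℝ, -(deriv Z ((2:ℝ) + t * I) / Z ((2:ℝ) + t * I)) * Ker (x+h) ((2:ℝ) + t * I)) = A1 at s1 hTe
  generalize (∫ t : ℝ, -(deriv Z ((2:ℝ) + t * I) / Z ((2:ℝ) + t * I)) * Ker x ((2:ℝ) + t * I)) = A2 at s2 hTe
  generalize (∫ t : ℝ, -(deriv Z ((2:ℝ) + t * I) / Z ((2:ℝ) + t * I)) * Ker (x-h) ((2:ℝ) + t * I)) = A3 at s3 hTe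
  have hs := (s1.sub (s2.mul_left 2)).add s3
  have hre := Complex.hasSum_re hs
  have hdiv := hre.mul_left (1 / (2 * Real.pi))
  have hpi := Real.pi_pos
  refine ⟨T.re / (2 * Real.pi) + h^2, ?_, ?_⟩
  · have e1 : (fun n : ℕ => vonMangoldt n * (max (x + h - n) 0 - 2 * max (x - n) 0 + max (x - h - n) 0)) = fun i : ℕ => 1 / (2 * Real.pi) *
        ((((2 * Real.pi * (vonMangoldt i * max (x + h - i) 0) : ℝ) : ℂ) - 2 * ((2 * Real.pi * (vonMangoldt i * max (x - i) 0) : ℝ) : ℂ) +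
            ((2 * Real.pi * (vonMangoldt i * max (x - h - i) 0) : ℝ) : ℂ)).re) := by
      funext n
      simp only [Complex.add_re, Complex.sub_re, Complex.ofReal_re, re_two_mul]
      field_simp
    rw [e1]
    refine hasSum_val hdiv ?_
    rw [hTe]
    simp only [Complex.add_re, Complex.sub_re, Complex.ofReal_re, re_two_mul]
    field_simp
    ring
  · rw [add_sub_cancel_right, abs_div, abs_of_pos (by positivity : (0:ℝ) < 2 * Real.pi)]
    have b := hB x h hx hh hhx
    calc |T.re| / (2 * Real.pi) ≤ |T.re| / 1 := by
          gcongr; linarith [Real.pi_gt_three]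
      _ = |T.re| := div_one _
      _ ≤ ‖T‖ := Complex.abs_re_le_norm T
      _ ≤ _ := b
end VK


namespace VK

lemma tent_le (x h : ℝ) (hh : 0 ≤ h) (n : ℝ) :
    max (x + h - n) 0 - 2 * max (x - n) 0 + max (x - h - n) 0 ≤ h := by
  rcases le_total (x + h - n) 0 with a | a <;> rcases le_total (x - n) 0 with b | b <;>
  rcases le_total (x - h - n) 0 with c | c <;> simp only [max_eq_left, max_eq_right, a, b, c] <;> linarith

lemma tent_zero (x h : ℝ) (hh : 0 ≤ h) (n : ℝ) (hn : n ≤ x - h ∨ x + h ≤ n) :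
    max (x + h - n) 0 - 2 * max (x - n) 0 + max (x - h - n) 0 = 0 := by
  rcases hn with hn | hn
  · rw [max_eq_left (by linarith), max_eq_left (by linarith), max_eq_left (by linarith)]; ring
  · rw [max_eq_right (by linarith), max_eq_right (by linarith), max_eq_right (by linarith)]; ring

open ArithmeticFunction in
lemma psi_lower1 (hRH : RiemannHypothesis) : ∃ C > 0, ∀ x h : ℝ, Real.exp 2 ≤ x → 1 ≤ h → h ≤ x/2 →
    h - C * (Real.sqrt x * Real.log x^2) ≤ Chebyshev.psi (x+h) - Chebyshev.psi (x-h) := by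
  obtain ⟨C, hC, hB⟩ := tent_bound hRH
  refine ⟨C, hC, fun x h hx hh hhx => ?_⟩
  obtain ⟨S, hS, hSb⟩ := hB x h hx hh hhx
  have hψ : Chebyshev.psi (x+h) - Chebyshev.psi (x-h) = ∑ n ∈ Finset.Ioc ⌊x-h⌋₊ ⌊x+h⌋₊, vonMangoldt n := by
    unfold Chebyshev.psi
    have hle : ⌊x-h⌋₊ ≤ ⌊x+h⌋₊ := Nat.floor_le_floor (by linarith)
    rw [← Finset.sum_Ioc_consecutive _ (Nat.zero_le _) hle]
    ring
  have hg : HasSum (fun n : ℕ => if n ∈ Finset.Ioc ⌊x-h⌋₊ ⌊x+h⌋₊ then h * vonMangoldt n else 0) (h * ∑ n ∈ Finset.Ioc ⌊x-h⌋₊ ⌊x+h⌋₊, vonMangoldt n) := by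
    have := hasSum_sum_of_ne_finset_zero (L := .unconditional ℕ) (f := fun n : ℕ => if n ∈ Finset.Ioc ⌊x-h⌋₊ ⌊x+h⌋₊ then h * vonMangoldt n else 0) (s := Finset.Ioc ⌊x-h⌋₊ ⌊x+h⌋₊) (fun b hb => if_neg hb)
    rw [Finset.sum_ite_mem, Finset.inter_self, ← Finset.mul_sum] at this
    exact this
  have hle := hasSum_le (fun n => ?_) hS hg
  · rw [← hψ] at hle
    have h1 := (abs_le.1 hSb).1
    have h2 : h * (h - C * (Real.sqrt x * Real.log x^2)) ≤ h * (Chebyshev.psi (x+h) - Chebyshev.psi (x-h)) := by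
      nlinarith
    exact le_of_mul_le_mul_left h2 (by linarith)
  · split_ifs with hn
    · rw [mul_comm]
      exact mul_le_mul_of_nonneg_right (tent_le x h (by linarith) n) vonMangoldt_nonneg
    · rw [tent_zero x h (by linarith) n, mul_zero]
      rw [Finset.mem_Ioc, not_and_or, not_lt, not_le] at hn
      rcases hn with hn | hn
      · left
        exact (Nat.le_floor_iff (by linarith)).1 hn
      · right
        exact ((Nat.floor_lt (by linarith)).1 hn).le

lemma rt_mono {y z : ℝ} (hy : 1 ≤ y) (hyz : y ≤ z) :
    Real.sqrt y * Real.log y^2 ≤ Real.sqrt z * Real.log z^2 := by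
  have := Real.log_nonneg hy
  gcongr

lemma exp2_lt : Real.exp 2 < 8 := by
  have : Real.exp 2 = Real.exp 1 * Real.exp 1 := by rw [← Real.exp_add]; norm_num
  rw [this]
  nlinarith [Real.exp_one_lt_d9, Real.exp_pos 1]

lemma psi_lower2 (hRH : RiemannHypothesis) : ∃ C > 0, ∀ y z : ℝ, 10 ≤ y → y ≤ z → z ≤ 3 * y →
    (z - y)/2 - C * (Real.sqrt z * Real.log z^2) ≤ Chebyshev.psi z - Chebyshev.psi y := by
  obtain ⟨C, hC, hB⟩ := psi_lower1 hRH
  refine ⟨C + 1, by positivity, fun y z hy hyz hz => ?_⟩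
  have hz0 : 0 ≤ Real.sqrt z * Real.log z^2 := by positivity
  rcases le_total 2 (z - y) with h2 | h2
  · have := hB ((y+z)/2) ((z-y)/2) (by linarith [exp2_lt]) (by linarith) (by linarith)
    rw [show (y+z)/2 + (z-y)/2 = z by ring, show (y+z)/2 - (z-y)/2 = y by ring] at this
    have h3 := rt_mono (y := (y+z)/2) (z := z) (by linarith) (by linarith)
    nlinarith
  · have h3 := Chebyshev.psi_mono hyz
    have hl : 2 ≤ Real.log z := by
      rw [Real.le_log_iff_exp_le (by linarith)]; linarith [exp2_lt]
    have hs : 1 ≤ Real.sqrt z := by rw [Real.one_le_sqrt]; linarith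
    have : 1 ≤ Real.sqrt z * Real.log z^2 := by nlinarith
    nlinarith

lemma theta_lower (hRH : RiemannHypothesis) : ∃ C > 0, ∀ y z : ℝ, 10 ≤ y → y ≤ z →
    (z - y)/3 - C * (Real.sqrt z * Real.log z^2) ≤ Chebyshev.theta z - Chebyshev.theta y := by
  obtain ⟨C, hC, hB⟩ := psi_lower2 hRH
  refine ⟨C + 2, by positivity, fun y z hy hyz => ?_⟩
  have h1 := Chebyshev.psi_sub_theta_le (x := z) (by linarith)
  have h2 := Chebyshev.theta_le_psi y
  have hl : 2 ≤ Real.log z := by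
    rw [Real.le_log_iff_exp_le (by linarith)]; linarith [exp2_lt]
  have h3 : Real.sqrt z * Real.log z ≤ Real.sqrt z * Real.log z^2 := by
    gcongr; nlinarith
  have h4 : (z - y)/3 - C * (Real.sqrt z * Real.log z^2) ≤ Chebyshev.psi z - Chebyshev.psi y := by
    rcases le_total z (3*y) with h | h
    · have := hB y z hy hyz h
      linarith
    · have := hB (z/3) z (by linarith) (by linarith) (by linarith)
      have hm := Chebyshev.psi_mono (show y ≤ z/3 by linarith)
      linarith
  nlinarith

end VK


namespace VK

open scoped Classical in
/-- Greedy partial sums. -/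
noncomputable def Sg (J : ℕ → ℂ) : ℕ → ℂ
  | 0 => 0
  | n + 1 => Sg J n + if (n+1).Prime ∧ Real.log (n+1 : ℕ) ≤ ‖J (n+1) - Sg J n‖ then
      (J (n+1) - Sg J n) / (‖J (n+1) - Sg J n‖ : ℂ) * (Real.log (n+1 : ℕ) : ℂ) else 0

/-- Greedy set of primes. -/
def Pg (J : ℕ → ℂ) : Set ℕ := {p | p.Prime ∧ Real.log p ≤ ‖J p - Sg J (p-1)‖}

/-- Greedy character. -/
noncomputable def Xg (J : ℕ → ℂ) (p : ℕ) : ℂ := (J p - Sg J (p-1)) / (‖J p - Sg J (p-1)‖ : ℂ)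

open scoped Classical in
lemma sum_Sg (J : ℕ → ℂ) (n : ℕ) :
    ∑ p ∈ Finset.filter (fun p => p.Prime ∧ p ∈ Pg J) (Finset.Iic n), Xg J p * (Real.log p : ℂ) = Sg J n := by
  rw [Finset.sum_filter, ← Nat.range_succ_eq_Iic]
  induction n with
  | zero => simp [Sg]
  | succ n ih =>
    rw [Finset.sum_range_succ, ih, Sg]
    congr 1
    simp only [Pg, Xg, mem_setOf_eq, Nat.add_sub_cancel]
    split_ifs with h1 h2 h2
    · rfl
    · exact absurd h1.2 h2
    · exact absurd ⟨h2.1, h2⟩ h1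
    · rfl

lemma Xg_norm (J : ℕ → ℂ) {p : ℕ} (hp : p ∈ Pg J) : ‖Xg J p‖ = 1 := by
  unfold Xg
  have h1 : 0 < Real.log p := Real.log_pos (by exact_mod_cast hp.1.one_lt)
  have h2 := hp.2
  rw [norm_div, Complex.norm_real, norm_norm, div_self]
  linarith

lemma greedy_step (J : ℕ → ℂ) (n : ℕ) :
    ‖J (n+1) - Sg J (n+1)‖ ≤ max (Real.log (n+1 : ℕ))
      (‖J n - Sg J n‖ + ‖J (n+1) - J n‖ - if (n+1).Prime then Real.log (n+1 : ℕ) else 0) := by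
  have hd : ‖J (n+1) - Sg J n‖ ≤ ‖J n - Sg J n‖ + ‖J (n+1) - J n‖ := by
    calc _ = ‖(J n - Sg J n) + (J (n+1) - J n)‖ := by congr 1; ring
      _ ≤ _ := norm_add_le _ _
  rw [Sg]
  by_cases hp : (n+1).Prime
  · have hl : 0 < Real.log (n+1 : ℕ) := Real.log_pos (by exact_mod_cast hp.one_lt)
    by_cases h : Real.log (n+1 : ℕ) ≤ ‖J (n+1) - Sg J n‖
    · rw [if_pos ⟨hp, h⟩, if_pos hp]
      apply le_max_of_le_right
      set d := J (n+1) - Sg J n with hdd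
      have hd0 : 0 < ‖d‖ := by linarith
      have hd1 : (‖d‖ : ℂ) ≠ 0 := by exact_mod_cast hd0.ne'
      have e : J (n+1) - (Sg J n + d / (‖d‖ : ℂ) * (Real.log (n+1 : ℕ) : ℂ)) = d * ((1 - Real.log (n+1 : ℕ) / ‖d‖ : ℝ) : ℂ) := by
        rw [← sub_sub, ← hdd]
        push_cast
        ring
      rw [e, norm_mul, Complex.norm_real, Real.norm_eq_abs, abs_of_nonneg (by rw [sub_nonneg, div_le_one hd0]; exact h)]
      have : ‖d‖ * (1 - Real.log (n+1 : ℕ) / ‖d‖) = ‖d‖ - Real.log (n+1 : ℕ) := by field_simp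
      rw [this]
      linarith
    · rw [if_neg (fun hh => h hh.2), add_zero]
      exact le_max_of_le_left (not_le.1 h).le
  · rw [if_neg (fun hh => hp hh.1), if_neg hp, add_zero, sub_zero]
    exact le_max_of_le_right hd

lemma theta_succ' (n : ℕ) : Chebyshev.theta ((n+1 : ℕ) : ℝ) = Chebyshev.theta (n : ℝ) + if (n+1).Prime then Real.log (n+1 : ℕ) else 0 := by
  unfold Chebyshev.theta
  rw [Nat.floor_natCast, Nat.floor_natCast, Finset.sum_filter, Finset.sum_filter, Finset.sum_Ioc_succ_top (Nat.zero_le n)]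

lemma greedy_ind (J : ℕ → ℂ) (N : ℕ) (hN : 1 ≤ N) (hJ : ∀ n ≥ N, ‖J (n+1) - J n‖ ≤ 1/3) :
    ∀ n ≥ N, ∃ k : ℕ, N ≤ k ∧ k ≤ n ∧ ‖J n - Sg J n‖ ≤ ‖J N - Sg J N‖ + Real.log k + Chebyshev.theta k - Chebyshev.theta n + ((n:ℝ) - k)/3 := by
  intro n hn
  induction n, hn using Nat.le_induction with
  | base =>
    refine ⟨N, le_rfl, le_rfl, ?_⟩
    have : 0 ≤ Real.log N := Real.log_natCast_nonneg N
    linarith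
  | succ n hn ih =>
    rcases le_max_iff.1 (greedy_step J n) with h | h
    · refine ⟨n+1, by omega, le_rfl, ?_⟩
      linarith [norm_nonneg (J N - Sg J N)]
    · obtain ⟨k, hk1, hk2, hk⟩ := ih
      refine ⟨k, hk1, by omega, ?_⟩
      have h3 := hJ n hn
      rw [theta_succ']
      push_cast at h ⊢
      linarith

lemma greedy_bound (hRH : RiemannHypothesis) (J : ℕ → ℂ) (N : ℕ) (hN : 10 ≤ N) (hJ : ∀ n ≥ N, ‖J (n+1) - J n‖ ≤ 1/3) :
    ∃ C > 0, ∀ n ≥ N, ‖J n - Sg J n‖ ≤ C * (Real.sqrt n * Real.log n^2) := by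
  obtain ⟨C, hC, hT⟩ := theta_lower hRH
  refine ⟨‖J N - Sg J N‖ + 1 + C, by positivity, fun n hn => ?_⟩
  obtain ⟨k, hk1, hk2, hk⟩ := greedy_ind J N (by omega) hJ n hn
  have hk10 : (10:ℝ) ≤ k := by exact_mod_cast hN.trans hk1
  have hkn : (k:ℝ) ≤ n := by exact_mod_cast hk2
  have ht := hT k n hk10 hkn
  have hl : 2 ≤ Real.log n := by
    rw [Real.le_log_iff_exp_le (by linarith)]; linarith [exp2_lt]
  have hs : 1 ≤ Real.sqrt n := by rw [Real.one_le_sqrt]; linarith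
  have h1 : Real.log k ≤ Real.log n := Real.log_le_log (by linarith) hkn
  have h2 : Real.log n ≤ Real.sqrt n * Real.log n^2 := by
    nlinarith [mul_le_mul_of_nonneg_right hs (sq_nonneg (Real.log n))]
  have h3 : 1 ≤ Real.sqrt n * Real.log n^2 := by linarith
  have h4 := norm_nonneg (J N - Sg J N)
  nlinarith

open scoped Classical in
lemma main_result (hRH : RiemannHypothesis) (q : ℝ → ℂ)
    (hqm : Measurable q) (hq0 : Tendsto q atTop (𝓝 0)) :
    ∃ (P : Set ℕ) (χ : ℕ → ℂ), (∀ p ∈ P, p.Prime) ∧ (∀ p ∈ P, ‖χ p‖ = 1) ∧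
      (fun x : ℝ => (∫ y in Ioc (1 : ℝ) x, q y) -
          ∑ p ∈ Finset.filter (fun p => p.Prime ∧ p ∈ P) (Finset.Iic ⌊x⌋₊),
            χ p * (Real.log p : ℂ))
        =O[atTop] fun x : ℝ => Real.sqrt x * Real.log x ^ 2 := by
  by_cases hintg : ∀ X : ℝ, IntegrableOn q (Ioc 1 X)
  swap
  · push Not at hintg
    obtain ⟨X, hX⟩ := hintg
    refine ⟨∅, fun _ => 1, by simp, by simp, ?_⟩
    refine Asymptotics.IsBigO.of_bound 0 ?_
    filter_upwards [eventually_ge_atTop X] with x hx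
    have : ¬ IntegrableOn q (Ioc 1 x) := fun h => hX (h.mono_set (Ioc_subset_Ioc_right hx))
    rw [integral_undef this]
    simp
  have hev : ∀ᶠ x in atTop, ‖q x‖ ≤ 1/3 := by
    have := hq0.norm
    rw [norm_zero] at this
    exact this.eventually (ge_mem_nhds (by norm_num))
  obtain ⟨M, hM⟩ := eventually_atTop.1 hev
  set N : ℕ := max 10 ⌈M⌉₊ with hNdef
  have hN10 : 10 ≤ N := le_max_left _ _
  have hNM : M ≤ N := (Nat.le_ceil M).trans (by exact_mod_cast le_max_right _ _)
  have hdiff : ∀ y z : ℝ, (N:ℝ) ≤ y → y ≤ z → ‖(∫ u in Ioc (1:ℝ) z, q u) - ∫ u in Ioc (1:ℝ) y, q u‖ ≤ 1/3 * (z - y) := by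
    intro y z hy hyz
    have hN1 : (10:ℝ) ≤ N := by exact_mod_cast hN10
    rw [← intervalIntegral.integral_of_le (by linarith), ← intervalIntegral.integral_of_le (by linarith),
      intervalIntegral.integral_interval_sub_left]
    · have := intervalIntegral.norm_integral_le_of_norm_le_const (f := q) (a := y) (b := z) (C := 1/3) (fun u hu => ?_)
      · rwa [abs_of_nonneg (by linarith)] at this
      · rw [uIoc_of_le hyz] at hu
        exact hM u (by linarith [hu.1])
    · rw [intervalIntegrable_iff_integrableOn_Ioc_of_le (by linarith)]; exact hintg z
    · rw [intervalIntegrable_iff_integrableOn_Ioc_of_le (by linarith)]; exact hintg y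
  set J : ℕ → ℂ := fun n => ∫ u in Ioc (1:ℝ) n, q u with hJdef
  obtain ⟨C, hC, hB⟩ := greedy_bound hRH J N hN10 (fun n hn => by
    have hn' : (N:ℝ) ≤ n := by exact_mod_cast hn
    have := hdiff n (n+1 : ℕ) hn' (by push_cast; linarith)
    push_cast at this
    simp only [hJdef]
    push_cast
    linarith)
  refine ⟨Pg J, Xg J, fun p hp => hp.1, fun p hp => Xg_norm J hp, ?_⟩
  refine Asymptotics.IsBigO.of_bound (C + 1) ?_
  filter_upwards [eventually_ge_atTop (N:ℝ)] with x hx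
  rw [sum_Sg]
  have hN1 : (10:ℝ) ≤ N := by exact_mod_cast hN10
  have hfl : (⌊x⌋₊ : ℝ) ≤ x := Nat.floor_le (by linarith)
  have hfl2 : x < ⌊x⌋₊ + 1 := Nat.lt_floor_add_one x
  have hNf : N ≤ ⌊x⌋₊ := Nat.le_floor hx
  have hNf' : (N:ℝ) ≤ ⌊x⌋₊ := by exact_mod_cast hNf
  have h1 := hdiff ⌊x⌋₊ x hNf' hfl
  have h2 := hB ⌊x⌋₊ hNf
  have h3 := rt_mono (y := ⌊x⌋₊) (z := x) (by linarith) hfl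
  have hl : 2 ≤ Real.log x := by
    rw [Real.le_log_iff_exp_le (by linarith)]; linarith [exp2_lt]
  have hs : 1 ≤ Real.sqrt x := by rw [Real.one_le_sqrt]; linarith
  have h4 : 1 ≤ Real.sqrt x * Real.log x^2 := by
    nlinarith [mul_le_mul_of_nonneg_right hs (sq_nonneg (Real.log x))]
  rw [Real.norm_of_nonneg (by positivity : (0:ℝ) ≤ Real.sqrt x * Real.log x^2)]
  calc _ = ‖((∫ u in Ioc (1:ℝ) x, q u) - J ⌊x⌋₊) + (J ⌊x⌋₊ - Sg J ⌊x⌋₊)‖ := by congr 1; ring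
    _ ≤ ‖(∫ u in Ioc (1:ℝ) x, q u) - J ⌊x⌋₊‖ + ‖J ⌊x⌋₊ - Sg J ⌊x⌋₊‖ := norm_add_le _ _
    _ ≤ 1/3 * (x - ⌊x⌋₊) + C * (Real.sqrt ⌊x⌋₊ * Real.log ⌊x⌋₊^2) := add_le_add h1 h2
    _ ≤ 1 + C * (Real.sqrt x * Real.log x^2) := by
        refine add_le_add (by linarith) (by gcongr)
    _ ≤ _ := by linarith
end VK


open scoped Classical in
/-- Under RH: for any measurable `q` with `q(x) = o(1)` as `x → ∞`, there exist a set `P` of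
primes and a unimodular `χ` on `P` such that
`r(x) := ∫₁^x q(y) dy − ∑_{p ≤ x, p ∈ P} χ(p) log p = O(√x (log x)²)`. -/
theorem exists_prime_set_remainder_bigO_RH (hRH : RiemannHypothesis) (q : ℝ → ℂ)
    (hqm : Measurable q) (hq0 : Tendsto q atTop (𝓝 0)) :
    ∃ (P : Set ℕ) (χ : ℕ → ℂ), (∀ p ∈ P, p.Prime) ∧ (∀ p ∈ P, ‖χ p‖ = 1) ∧
      (fun x : ℝ => (∫ y in Ioc (1 : ℝ) x, q y) -
          ∑ p ∈ Finset.filter (fun p => p.Prime ∧ p ∈ P) (Finset.Iic ⌊x⌋₊),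
            χ p * (Real.log p : ℂ))
        =O[atTop] fun x : ℝ => Real.sqrt x * Real.log x ^ 2 := by
  exact VK.main_result hRH q hqm hq0
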